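/- Let M be a weight sequence satisfying (M.2) and (M.2)*. Let E be a Banach space and π : ℝ^d → GL(E) a group homomorphism into the invertible bounded operators on E such that (x,e) ↦ π(x)e is continuous and ‖π(x)e‖_E ≤ C e^{κ|x|}‖e‖_E for some C, κ > 0 and all x ∈ ℝ^d, e ∈ E. Then Π(𝒦^{{M}}(ℝ^d))E = Π(𝒦^{{M}}(ℝ^d))E^{{M}} = E^{{M}}; explicitly: (a) for every f ∈ 𝒦^{{M}}(ℝ^d) and every e ∈ E one has Π(f)e ∈ E^{{M}}; (b) for every e ∈ E^{{M}} there exist ψ ∈ 𝒦^{{M}}(ℝ^d) and v ∈ E^{{M}} with e = Π(ψ)v. Moreover, for every set B̃ ⊆ E^{{M}} that is bounded in E^{{M}} (i.e., there is h > 0 with sup_{e∈B̃} sup_α h^{|α|}‖e_α‖_E/M_α < ∞) there exist ψ ∈ 𝒦^{{M}}(ℝ^d) and a bounded set Ã ⊆ E^{{M}} with Π(ψ)Ã = B̃. -/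

import Mathlib

open Filter MeasureTheory
open scoped BigOperators

noncomputable section

abbrev Rd (d : ℕ) := EuclideanSpace ℝ (Fin d)

/-- Partial derivative in the `j`-th coordinate direction. -/
def dop {d : ℕ} {E : Type*} [NormedAddCommGroup E] [NormedSpace ℝ E]
    (j : Fin d) (f : Rd d → E) : Rd d → E :=
  fun x => fderiv ℝ f x (EuclideanSpace.single j (1:ℝ))

/-- Iterated partial derivative `∂^α` for a multi-index `α : Fin d → ℕ`. -/
def pD {d : ℕ} {E : Type*} [NormedAddCommGroup E] [NormedSpace ℝ E]
    (α : Fin d → ℕ) (f : Rd d → E) : Rd d → E :=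
  (List.finRange d).foldr (fun j g => (dop j)^[α j] g) f

/-- Length `|α|` of a multi-index. -/
def msize {d : ℕ} (α : Fin d → ℕ) : ℕ := ∑ j, α j

/-- `M` is a weight sequence: positive, normalized, `M_p^{1/p} → ∞`, log-convex. -/
def IsWeightSeq (M : ℕ → ℝ) : Prop :=
  (∀ p, 0 < M p) ∧ M 0 = 1 ∧ M 1 = 1 ∧
  Tendsto (fun p : ℕ => (M p) ^ ((p : ℝ)⁻¹)) atTop atTop ∧
  ∀ p : ℕ, 1 ≤ p → (M p)^2 ≤ M (p-1) * M (p+1)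

/-- Condition (M.2) with explicit constants `C₀, H ≥ 1`. -/
def HasM2 (M : ℕ → ℝ) (C₀ H : ℝ) : Prop :=
  1 ≤ C₀ ∧ 1 ≤ H ∧ ∀ p q : ℕ, M (p+q) ≤ C₀ * H^(p+q) * M p * M q

/-- Condition (M.2). -/
def M2 (M : ℕ → ℝ) : Prop := ∃ C₀ H, HasM2 M C₀ H

/-- Condition (M.2)*: `2 m_p ≤ m_{Np}` for `p ≥ p₀`. -/
def M2star (M : ℕ → ℝ) : Prop :=
  ∃ p₀ N : ℕ, 0 < p₀ ∧ 0 < N ∧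
    ∀ p, p₀ ≤ p → 2 * (M p / M (p-1)) ≤ M (N*p) / M (N*p - 1)

/-- Associated function `ν_M(t) = sup_p log(t^p / M_p)`. -/
def nuA (M : ℕ → ℝ) (t : ℝ) : ℝ := ⨆ p : ℕ, Real.log (t ^ p / M p)

/-- `φ ∈ 𝒦^{(M)}(ℝ^d)` (Beurling type). -/
def KBeu (d : ℕ) (M : ℕ → ℝ) (φ : Rd d → ℂ) : Prop :=
  ContDiff ℝ (⊤ : ℕ∞) φ ∧ ∀ k : ℝ, 0 < k → ∀ n : ℕ, ∃ C : ℝ,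
    ∀ (α : Fin d → ℕ) (x : Rd d),
      k ^ msize α * ‖pD α φ x‖ * Real.exp ((n : ℝ) * ‖x‖) ≤ C * M (msize α)

/-- `φ ∈ 𝒦^{{M}}(ℝ^d)` (Roumieu type). -/
def KRou (d : ℕ) (M : ℕ → ℝ) (φ : Rd d → ℂ) : Prop :=
  ContDiff ℝ (⊤ : ℕ∞) φ ∧ ∃ k : ℝ, 0 < k ∧ ∀ n : ℕ, ∃ C : ℝ,
    ∀ (α : Fin d → ℕ) (x : Rd d),
      k ^ msize α * ‖pD α φ x‖ * Real.exp ((n : ℝ) * ‖x‖) ≤ C * M (msize α)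

/-- Orbit map `γ_e(x) = π(x)e` of a representation of `(ℝ^d,+)`. -/
def orbit {d : ℕ} {E : Type*} [NormedAddCommGroup E] [NormedSpace ℂ E]
    (π : Rd d → E →L[ℂ] E) (e : E) : Rd d → E := fun x => π x e

/-- The action `Π(f)e = ∫_{ℝ^d} f(x) π(x)e dx` (Bochner integral). -/
def PiOp {d : ℕ} {E : Type*} [NormedAddCommGroup E] [NormedSpace ℂ E] [CompleteSpace E]
    (π : Rd d → E →L[ℂ] E) (f : Rd d → ℂ) (e : E) : E :=
  ∫ x : Rd d, f x • (π x e)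

/-- `e ∈ E^{{M}}`: Roumieu ultradifferentiable vector of a Banach representation. -/
def UVRou (d : ℕ) (M : ℕ → ℝ) {E : Type*} [NormedAddCommGroup E] [NormedSpace ℂ E]
    (π : Rd d → E →L[ℂ] E) (e : E) : Prop :=
  ContDiff ℝ (⊤ : ℕ∞) (orbit π e) ∧ ∃ k : ℝ, 0 < k ∧ ∃ C : ℝ,
    ∀ α : Fin d → ℕ, k ^ msize α * ‖pD α (orbit π e) 0‖ ≤ C * M (msize α)

/-- Bounded subset of `E^{{M}}`. -/
def UVRouBdd (d : ℕ) (M : ℕ → ℝ) {E : Type*} [NormedAddCommGroup E] [NormedSpace ℂ E]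
    (π : Rd d → E →L[ℂ] E) (B : Set E) : Prop :=
  (∀ e ∈ B, UVRou d M π e) ∧ ∃ k : ℝ, 0 < k ∧ ∃ C : ℝ,
    ∀ e ∈ B, ∀ α : Fin d → ℕ, k ^ msize α * ‖pD α (orbit π e) 0‖ ≤ C * M (msize α)

/-! ### Weight sequences -/

/-- The quotients `M_{j+1} / M_j` of a weight sequence. -/
def wquot (M : ℕ → ℝ) (j : ℕ) : ℝ := M (j + 1) / M j

/-- The polynomial `∏_{p < n} (1 + u_p X)`. -/
def symPoly (u : ℕ → ℝ) (n : ℕ) : Polynomial ℝ :=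
  ∏ p ∈ Finset.range n, (1 + Polynomial.C (u p) * Polynomial.X)

/-- The weight function `∑_p log (1 + u_p t^s)`. -/
def symW (u : ℕ → ℝ) (s : ℕ) (t : ℝ) : ℝ := ∑' p, Real.log (1 + u p * t ^ s)

section Weights

variable {M : ℕ → ℝ}

lemma wquot_pos (hM : IsWeightSeq M) (j : ℕ) : 0 < wquot M j :=
  div_pos (hM.1 _) (hM.1 _)

lemma wquot_mono (hM : IsWeightSeq M) : Monotone (wquot M) := by
  refine monotone_nat_of_le_succ fun j => ?_
  have h := hM.2.2.2.2 (j + 1) (by omega)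
  simp only [add_tsub_cancel_right] at h
  unfold wquot
  rw [div_le_div_iff₀ (hM.1 _) (hM.1 _)]
  nlinarith

lemma one_le_wquot (hM : IsWeightSeq M) (j : ℕ) : 1 ≤ wquot M j := by
  have h : wquot M 0 = 1 := by simp [wquot, hM.2.1, hM.2.2.1]
  exact h ▸ wquot_mono hM (Nat.zero_le j)

lemma M_succ (hM : IsWeightSeq M) (j : ℕ) : M (j + 1) = M j * wquot M j := by
  have := (hM.1 j).ne'
  unfold wquot; field_simp

lemma M_mono (hM : IsWeightSeq M) : Monotone M := by
  refine monotone_nat_of_le_succ fun j => ?_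
  rw [M_succ hM]
  exact le_mul_of_one_le_right (hM.1 j).le (one_le_wquot hM j)

lemma one_le_M (hM : IsWeightSeq M) (j : ℕ) : 1 ≤ M j :=
  hM.2.1 ▸ M_mono hM (Nat.zero_le j)

lemma M_mul_le (hM : IsWeightSeq M) (p q : ℕ) : M p * M q ≤ M (p + q) := by
  induction q with
  | zero => simp [hM.2.1]
  | succ q ih =>
    rw [M_succ hM, ← add_assoc, M_succ hM, ← mul_assoc]
    exact mul_le_mul ih (wquot_mono hM (by omega)) (wquot_pos hM _).le (hM.1 _).le

lemma M_prod_le (hM : IsWeightSeq M) {ι : Type*} (t : Finset ι) (α : ι → ℕ) :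
    ∏ j ∈ t, M (α j) ≤ M (∑ j ∈ t, α j) := by
  classical
  induction t using Finset.induction_on with
  | empty => simp [hM.2.1]
  | insert a t ha ih =>
    rw [Finset.prod_insert ha, Finset.sum_insert ha]
    exact (mul_le_mul_of_nonneg_left ih (hM.1 _).le).trans (M_mul_le hM _ _)

lemma M_sum_le (hM : IsWeightSeq M) {C H : ℝ} (h : HasM2 M C H) {ι : Type*} (t : Finset ι)
    (α : ι → ℕ) :
    M (∑ j ∈ t, α j) ≤ C ^ t.card * (H ^ t.card) ^ (∑ j ∈ t, α j) * ∏ j ∈ t, M (α j) := by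
  classical
  obtain ⟨hC, hH, h2⟩ := h
  induction t using Finset.induction_on with
  | empty => simp [hM.2.1]
  | insert a t ha ih =>
    rw [Finset.prod_insert ha, Finset.sum_insert ha, Finset.card_insert_of_notMem ha]
    set S := ∑ j ∈ t, α j
    set Q := ∏ j ∈ t, M (α j)
    have hQ : 0 < Q := Finset.prod_pos fun j _ => hM.1 _
    have hMa := hM.1 (α a)
    calc M (α a + S) ≤ C * H ^ (α a + S) * M (α a) * M S := h2 _ _
      _ ≤ C * H ^ (α a + S) * M (α a) * (C ^ t.card * (H ^ t.card) ^ S * Q) := by gcongr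
      _ ≤ C * H ^ (α a + S) * M (α a) * (C ^ t.card * (H ^ t.card) ^ (α a + S) * Q) := by
          gcongr
          · exact one_le_pow₀ hH
          · omega
      _ = _ := by rw [pow_succ C, pow_succ H, mul_pow]; ring

lemma M_double (hM : IsWeightSeq M) {C H : ℝ} (h : HasM2 M C H) (n : ℕ) :
    M (8 * n) ≤ C ^ 8 * (H ^ 8) ^ (8 * n) * M n ^ 8 := by
  have := M_sum_le hM h (Finset.univ : Finset (Fin 8)) (fun _ => n)
  simpa using this

lemma M_eq_prod (hM : IsWeightSeq M) (n : ℕ) : M n = ∏ j ∈ Finset.range n, wquot M j := by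
  induction n with
  | zero => simp [hM.2.1]
  | succ n ih => rw [M_succ hM, ih, Finset.prod_range_succ]

lemma wquot_iterate {p₀ N : ℕ} (hN : 0 < N)
    (h : ∀ p, p₀ ≤ p → 2 * wquot M (p - 1) ≤ wquot M (N * p - 1)) (l p : ℕ) (hp : p₀ ≤ p) :
    2 ^ l * wquot M (p - 1) ≤ wquot M (N ^ l * p - 1) := by
  induction l with
  | zero => simp
  | succ l ih =>
    have h1 := h (N ^ l * p) (hp.trans (Nat.le_mul_of_pos_left _ (pow_pos hN _)))
    rw [show N ^ (l + 1) * p = N * (N ^ l * p) by ring]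
    calc 2 ^ (l + 1) * wquot M (p - 1) = 2 * (2 ^ l * wquot M (p - 1)) := by ring
      _ ≤ _ := by linarith

lemma wquot_ratio (hM : IsWeightSeq M) {p₀ N : ℕ} (hp₀ : 0 < p₀) (hN : 2 ≤ N)
    (h : ∀ p, p₀ ≤ p → 2 * wquot M (p - 1) ≤ wquot M (N * p - 1)) {x y : ℕ} (hy : p₀ ≤ y)
    (hxy : y ≤ x) :
    (wquot M (y - 1) / wquot M (x - 1)) ^ (8 * N) ≤ (N : ℝ) ^ 2 * ((y : ℝ) / x) ^ 2 := by
  have hy0 : 0 < y := by omega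
  have hx0 : 0 < x := by omega
  set l := Nat.log N (x / y)
  have hq : x / y ≠ 0 := (Nat.div_pos hxy hy0).ne'
  have h1 : N ^ l * y ≤ x := by
    have := Nat.pow_log_le_self N hq
    exact (Nat.mul_le_mul_right y this).trans (Nat.div_mul_le_self x y)
  have h2 : x < N ^ (l + 1) * y := by
    have := Nat.lt_pow_succ_log_self (b := N) (by omega) (x / y)
    exact (Nat.div_lt_iff_lt_mul hy0).1 this
  have h3 : 2 ^ l * wquot M (y - 1) ≤ wquot M (x - 1) :=
    (wquot_iterate (by omega) h l y hy).trans (wquot_mono hM (by omega))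
  have hwx := wquot_pos hM (x - 1)
  have hwy := wquot_pos hM (y - 1)
  have h4 : wquot M (y - 1) / wquot M (x - 1) ≤ (1 / 2) ^ l := by
    rw [div_le_iff₀ hwx, one_div, inv_pow, inv_mul_eq_div, le_div_iff₀ (by positivity)]
    linarith
  have hN0 : (0 : ℝ) < N := by positivity
  have h5 : (1 / 2 : ℝ) ^ (8 * N) ≤ (1 / N) ^ 2 := by
    have : (N : ℝ) ≤ 2 ^ N := by exact_mod_cast (Nat.lt_two_pow_self).le
    calc (1 / 2 : ℝ) ^ (8 * N) ≤ (1 / 2) ^ (N * 2) :=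
          pow_le_pow_of_le_one (by norm_num) (by norm_num) (by omega)
      _ = ((1 / 2) ^ N) ^ 2 := pow_mul _ _ _
      _ ≤ _ := by
        gcongr
        rw [one_div, inv_pow, one_div]
        gcongr
  have hx0' : (0 : ℝ) < x := by exact_mod_cast hx0
  have h6 : (1 / N : ℝ) ^ (l + 1) ≤ y / x := by
    rw [one_div, inv_pow, inv_eq_one_div, div_le_div_iff₀ (by positivity) hx0']
    have : (x : ℝ) < N ^ (l + 1) * y := by exact_mod_cast h2
    linarith
  calc (wquot M (y - 1) / wquot M (x - 1)) ^ (8 * N) ≤ ((1 / 2) ^ l) ^ (8 * N) := by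
        gcongr
    _ = ((1 / 2) ^ (8 * N)) ^ l := by rw [← pow_mul, ← pow_mul, mul_comm]
    _ ≤ ((1 / N) ^ 2) ^ l := by gcongr
    _ = N ^ 2 * ((1 / N) ^ (l + 1)) ^ 2 := by
        rw [← pow_mul, ← pow_mul, show (l + 1) * 2 = 2 + 2 * l by ring, pow_add, ← mul_assoc,
          ← mul_pow, mul_one_div_cancel hN0.ne', one_pow, one_mul]
    _ ≤ _ := by gcongr

lemma sum_inv_sq_le (q n : ℕ) (hq : 0 < q) (k : ℕ) :
    ∑ p ∈ Finset.Ico k n, (1 / ((p : ℝ) + q)) ^ 2 ≤ 2 / ((k : ℝ) + q) := by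
  have hq' : (1 : ℝ) ≤ q := by exact_mod_cast hq
  rcases le_or_gt n k with h | h
  · rw [Finset.Ico_eq_empty (by omega)]; simp; positivity
  have key : ∀ n, k ≤ n →
      ∑ p ∈ Finset.Ico k n, (1 / ((p : ℝ) + q)) ^ 2 ≤ 2 / ((k : ℝ) + q) - 2 / ((n : ℝ) + q) := by
    intro n hn
    induction n, hn using Nat.le_induction with
    | base => simp
    | succ n hn ih =>
      rw [Finset.sum_Ico_succ_top hn]
      have hn0 : (0 : ℝ) ≤ n := by positivity
      have : (1 / ((n : ℝ) + q)) ^ 2 ≤ 2 / ((n : ℝ) + q) - 2 / (((n + 1 : ℕ) : ℝ) + q) := by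
        push_cast
        rw [div_sub_div _ _ (by positivity) (by positivity), div_pow, one_pow,
          div_le_div_iff₀ (by positivity) (by positivity)]
        nlinarith [mul_nonneg hn0 hn0]
      linarith
  have := key n h.le
  have h2 : 0 ≤ 2 / ((n : ℝ) + q) := by positivity
  linarith

end Weights

lemma symPoly_coeff_nonneg {u : ℕ → ℝ} (hu : ∀ p, 0 < u p) (n k : ℕ) :
    0 ≤ (symPoly u n).coeff k := by
  induction n generalizing k with
  | zero => simp [symPoly, Polynomial.coeff_one]; split_ifs <;> norm_num
  | succ n ih =>
    have : symPoly u (n + 1) = symPoly u n + Polynomial.C (u n) * (symPoly u n * Polynomial.X) := by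
      simp only [symPoly, Finset.prod_range_succ]; ring
    rw [this, Polynomial.coeff_add, Polynomial.coeff_C_mul]
    cases k with
    | zero => simpa using ih 0
    | succ k =>
      rw [Polynomial.coeff_mul_X]
      have := ih k
      have := ih (k + 1)
      have := hu n
      positivity

lemma symPoly_coeff_mono {u : ℕ → ℝ} (hu : ∀ p, 0 < u p) (k : ℕ) :
    Monotone fun n => (symPoly u n).coeff k := by
  refine monotone_nat_of_le_succ fun n => ?_
  have : symPoly u (n + 1) = symPoly u n + Polynomial.C (u n) * (symPoly u n * Polynomial.X) := by
    simp only [symPoly, Finset.prod_range_succ]; ring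
  rw [this, Polynomial.coeff_add, Polynomial.coeff_C_mul]
  cases k with
  | zero => simp
  | succ k =>
    rw [Polynomial.coeff_mul_X]
    have := symPoly_coeff_nonneg hu n k
    have := hu n
    simp only [le_add_iff_nonneg_right]; positivity

lemma symPoly_natDegree_le (u : ℕ → ℝ) (n : ℕ) : (symPoly u n).natDegree ≤ n := by
  refine (Polynomial.natDegree_prod_le _ _).trans ?_
  refine (Finset.sum_le_card_nsmul _ _ 1 fun p _ => ?_).trans (by simp)
  compute_degree

lemma symPoly_eval (u : ℕ → ℝ) (n : ℕ) (x : ℝ) :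
    (symPoly u n).eval x = ∏ p ∈ Finset.range n, (1 + u p * x) := by
  simp [symPoly, Polynomial.eval_prod]

lemma symPoly_coeff_mul_pow_le {u : ℕ → ℝ} (hu : ∀ p, 0 < u p) (n k : ℕ) {x : ℝ} (hx : 0 ≤ x) :
    (symPoly u n).coeff k * x ^ k ≤ ∏ p ∈ Finset.range n, (1 + u p * x) := by
  rw [← symPoly_eval]
  by_cases hk : k ≤ n
  · rw [Polynomial.eval_eq_sum_range' (Nat.lt_succ_of_le (symPoly_natDegree_le u n))]
    exact Finset.single_le_sum (f := fun k => (symPoly u n).coeff k * x ^ k)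
      (fun i _ => mul_nonneg (symPoly_coeff_nonneg hu n i) (pow_nonneg hx _))
      (Finset.mem_range.2 (by omega))
  · rw [Polynomial.coeff_eq_zero_of_natDegree_lt (by have := symPoly_natDegree_le u n; omega),
      zero_mul, symPoly_eval]
    exact Finset.prod_nonneg fun p _ => by have := hu p; positivity

lemma symW_summable {u : ℕ → ℝ} (hu : ∀ p, 0 < u p) (hs : Summable u) {x : ℝ} (hx : 0 ≤ x) :
    Summable fun p => Real.log (1 + u p * x) := by
  refine Summable.of_nonneg_of_le (fun p => Real.log_nonneg ?_) (fun p => ?_) (hs.mul_right x)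
  · have := hu p; nlinarith [mul_nonneg this.le hx]
  · have h0 : 0 ≤ u p * x := mul_nonneg (hu p).le hx
    have := Real.log_le_sub_one_of_pos (x := 1 + u p * x) (by linarith)
    linarith

lemma symW_scale (u : ℕ → ℝ) (s : ℕ) (μ t : ℝ) :
    symW (fun p => u p * μ ^ s) s t = symW u s (μ * t) := by
  simp only [symW, mul_pow, mul_assoc]

lemma symPoly_scale (u : ℕ → ℝ) (c : ℝ) (n k : ℕ) :
    (symPoly (fun p => u p * c) n).coeff k = (symPoly u n).coeff k * c ^ k := by
  have : symPoly (fun p => u p * c) n = (symPoly u n).comp (Polynomial.C c * Polynomial.X) := by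
    simp only [symPoly, Polynomial.prod_comp]
    refine Finset.prod_congr rfl fun p _ => ?_
    simp [mul_assoc]
  rw [this, Polynomial.comp_C_mul_X_coeff]

section

variable {M : ℕ → ℝ} (hM : IsWeightSeq M) {u : ℕ → ℝ} {s p₀ : ℕ}
  (hs : 0 < s) (hp₀ : 0 < p₀) (hu : ∀ p, u p = 1 / wquot M (s * (p + p₀) - 1) ^ s)
include hM hs hp₀ hu

lemma prod_inv_ge (k : ℕ) : M (s * k) ≤ ∏ p ∈ Finset.range k, (u p)⁻¹ := by
  induction k with
  | zero => simp [hM.2.1]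
  | succ k ih =>
    rw [Finset.prod_range_succ, mul_add, mul_one, M_eq_prod hM, Finset.prod_range_add,
      ← M_eq_prod hM]
    refine mul_le_mul ih ?_ (Finset.prod_nonneg fun _ _ => (wquot_pos hM _).le)
      ((hM.1 _).le.trans ih)
    rw [hu, one_div, inv_inv]
    refine (Finset.prod_le_prod (fun _ _ => (wquot_pos hM _).le)
      (fun i hi => wquot_mono hM (show s * k + i ≤ s * (k + p₀) - 1 from ?_))).trans (by simp)
    have := Finset.mem_range.1 hi
    have : s * (k + 1) ≤ s * (k + p₀) := by gcongr; omega
    rw [mul_add, mul_one] at this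
    omega

lemma prod_inv_le (k : ℕ) : ∏ p ∈ Finset.range k, (u p)⁻¹ ≤ M (s * (k + p₀)) := by
  induction k with
  | zero => simpa using one_le_M hM _
  | succ k ih =>
    rw [Finset.prod_range_succ, show s * (k + 1 + p₀) = s * (k + p₀) + s by ring, M_eq_prod hM,
      Finset.prod_range_add, ← M_eq_prod hM]
    refine mul_le_mul ih ?_ ?_ (hM.1 _).le
    · rw [hu, one_div, inv_inv]
      refine le_trans (by simp) (Finset.prod_le_prod (s := Finset.range s)
        (fun _ _ => (wquot_pos hM _).le)
        (fun i hi => wquot_mono hM (show s * (k + p₀) - 1 ≤ s * (k + p₀) + i from ?_)))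
      omega
    · rw [hu, one_div, inv_inv]; exact pow_nonneg (wquot_pos hM _).le _

lemma symSeq_pos (p : ℕ) : 0 < u p := by
  rw [hu]; exact one_div_pos.2 (pow_pos (wquot_pos hM _) _)

lemma exp_neg_symW_le (hsum : Summable u) {C H : ℝ} (h2 : HasM2 M C H) {N : ℕ} (hN : 0 < N)
    (hsN : s = 8 * N) (he : Even s) :
    ∃ K L : ℝ, 0 < K ∧ 0 < L ∧
      ∀ n (t : ℝ), |t| ^ n * Real.exp (-(symW u s t) / 8) ≤ K * L ^ n * M n := by
  have hpos := symSeq_pos hM hs hp₀ hu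
  have hC := h2.1
  have hH := h2.2.1
  set c := s + s * p₀ with hc
  set A := C * H ^ c * M c * C ^ 8 with hA
  have hMc := one_le_M hM c
  have hA1 : 1 ≤ A := by
    have := one_le_pow₀ hH (n := c)
    have := one_le_pow₀ hC (n := 8)
    rw [hA]
    exact one_le_mul_of_one_le_of_one_le (one_le_mul_of_one_le_of_one_le
      (one_le_mul_of_one_le_of_one_le hC (by assumption)) hMc) (by assumption)
  refine ⟨A, H * H ^ 8, by linarith, by positivity, fun n t => ?_⟩
  have hMn := one_le_M hM n
  have hR : 1 ≤ A * (H * H ^ 8) ^ n * M n := by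
    have := one_le_pow₀ (one_le_mul_of_one_le_of_one_le hH (one_le_pow₀ hH (n := 8))) (n := n)
    exact one_le_mul_of_one_le_of_one_le (one_le_mul_of_one_le_of_one_le hA1 this) hMn
  have hW : ∀ x : ℝ, 0 ≤ x ^ s := fun x => he.pow_nonneg x
  have hnn : 0 ≤ symW u s t := tsum_nonneg fun p => Real.log_nonneg (by
    have := mul_nonneg (hpos p).le (hW t); linarith)
  rcases le_or_gt |t| 1 with ht | ht
  · refine le_trans ?_ hR
    exact mul_le_one₀ (pow_le_one₀ (abs_nonneg _) ht) (Real.exp_pos _).le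
      (Real.exp_le_one_iff.2 (by linarith))
  · have ht0 : 0 < |t| := by linarith
    set k := n / N + 1
    have hk1 : 8 * n ≤ s * k := by
      have := Nat.div_add_mod n N
      have := Nat.mod_lt n hN
      have : n ≤ N * k := by simp only [k, mul_add, mul_one]; omega
      rw [hsN]; nlinarith
    have hk2 : s * (k + p₀) ≤ 8 * n + c := by
      have := Nat.div_mul_le_self n N
      have h3 : s * k = 8 * (n / N * N) + s := by simp only [k, hsN]; ring
      rw [mul_add, h3, hc]; omega
    have h1 : Real.exp (-(symW u s t)) * |t| ^ (s * k) ≤ M (s * (k + p₀)) := by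
      have hsum' := symW_summable hpos hsum (hW t)
      have h4 : ∑ p ∈ Finset.range k, Real.log (1 + u p * t ^ s) ≤ symW u s t :=
        hsum'.sum_le_tsum _ fun p _ => Real.log_nonneg (by
          have := mul_nonneg (hpos p).le (hW t); linarith)
      have h5 : Real.exp (∑ p ∈ Finset.range k, Real.log (1 + u p * t ^ s)) =
          ∏ p ∈ Finset.range k, (1 + u p * t ^ s) := by
        rw [Real.exp_sum]
        exact Finset.prod_congr rfl fun p _ => Real.exp_log (by
          have := mul_nonneg (hpos p).le (hW t); linarith)
      have h6 : ∏ p ∈ Finset.range k, (u p * |t| ^ s) ≤ Real.exp (symW u s t) := by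
        refine le_trans ?_ (Real.exp_le_exp.2 h4)
        rw [h5]
        refine Finset.prod_le_prod (fun p _ => by have := hpos p; positivity) fun p _ => ?_
        rw [he.pow_abs]; linarith
      rw [Finset.prod_mul_distrib, Finset.prod_const, Finset.card_range, ← pow_mul] at h6
      rw [Real.exp_neg, inv_mul_le_iff₀ (Real.exp_pos _)]
      have h7 := prod_inv_le hM hs hp₀ hu k
      have h8 : 0 < ∏ p ∈ Finset.range k, u p := Finset.prod_pos fun p _ => hpos p
      rw [Finset.prod_inv_distrib] at h7
      calc |t| ^ (s * k) = ((∏ p ∈ Finset.range k, u p) * |t| ^ (s * k)) *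
              (∏ p ∈ Finset.range k, u p)⁻¹ := by field_simp
        _ ≤ _ := by gcongr
    have h9 : M (s * (k + p₀)) ≤ C * H ^ (8 * n + c) * (C ^ 8 * (H ^ 8) ^ (8 * n) * M n ^ 8) * M c :=
      ((M_mono hM hk2).trans (h2.2.2 _ _)).trans (by
        have := M_double hM h2 n
        gcongr)
    have h10 : (|t| ^ n * Real.exp (-(symW u s t) / 8)) ^ 8 ≤ (A * (H * H ^ 8) ^ n * M n) ^ 8 := by
      rw [mul_pow, ← pow_mul, ← Real.exp_nat_mul]
      calc |t| ^ (n * 8) * Real.exp ((8 : ℕ) * (-(symW u s t) / 8))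
          ≤ |t| ^ (s * k) * Real.exp (-(symW u s t)) := by
            refine mul_le_mul (pow_le_pow_right₀ ht.le (by omega))
              (Real.exp_le_exp.2 ?_) (Real.exp_pos _).le (by positivity)
            push_cast; linarith
        _ ≤ C * H ^ (8 * n + c) * (C ^ 8 * (H ^ 8) ^ (8 * n) * M n ^ 8) * M c := by
            rw [mul_comm]; exact h1.trans h9
        _ = A * ((H * H ^ 8) ^ n * M n) ^ 8 := by rw [hA]; ring
        _ ≤ A ^ 8 * ((H * H ^ 8) ^ n * M n) ^ 8 := by
            gcongr; exact le_self_pow₀ hA1 (by norm_num)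
        _ = _ := by ring
    exact le_of_pow_le_pow_left₀ (by norm_num) (by linarith) h10

lemma symPoly_coeff_le {B : ℝ} (hB : ∀ k n, ∑ p ∈ Finset.Ico k n, u p / u k ≤ B * (k + p₀)) :
    ∃ K L : ℝ, 0 < K ∧ 0 < L ∧ ∀ n k, (symPoly u n).coeff k ≤ K * L ^ k / M (s * k) := by
  have hpos := symSeq_pos hM hs hp₀ hu
  refine ⟨Real.exp (B * p₀), 2 * Real.exp B, Real.exp_pos _, by positivity, fun n k => ?_⟩
  refine (symPoly_coeff_mono hpos k (le_max_left n k)).trans ?_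
  set m := max n k
  have hkm : k ≤ m := le_max_right _ _
  have huk := hpos k
  have h1 := symPoly_coeff_mul_pow_le hpos m k (inv_nonneg.2 huk.le)
  have h2 : ∏ p ∈ Finset.range m, (1 + u p * (u k)⁻¹) ≤
      (∏ p ∈ Finset.range k, (2 * (u p * (u k)⁻¹))) * Real.exp (B * (k + p₀)) := by
    rw [← Finset.prod_range_mul_prod_Ico _ hkm]
    refine mul_le_mul ?_ ?_ ?_ ?_
    · refine Finset.prod_le_prod (fun p _ => by have := hpos p; positivity) fun p hp => ?_
      have hup := hpos p
      have : 1 ≤ u p * (u k)⁻¹ := by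
        rw [← div_eq_mul_inv, one_le_div huk, hu, hu]
        have := wquot_pos hM (s * (p + p₀) - 1)
        gcongr
        refine wquot_mono hM ?_
        have := Finset.mem_range.1 hp
        have : s * (p + p₀) ≤ s * (k + p₀) := by gcongr
        omega
      linarith
    · refine le_trans (Finset.prod_le_prod (fun p _ => by have := hpos p; positivity)
        (fun p _ => ?_)) ((Real.exp_sum _ _).symm.le.trans (Real.exp_le_exp.2 (hB k m)))
      rw [← div_eq_mul_inv, add_comm]
      exact Real.add_one_le_exp _
    · exact Finset.prod_nonneg fun p _ => by have := hpos p; positivity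
    · exact Finset.prod_nonneg fun p _ => by have := hpos p; positivity
  have h3 := prod_inv_ge hM hs hp₀ hu k
  have hM0 := hM.1 (s * k)
  have h8 : 0 < ∏ p ∈ Finset.range k, u p := Finset.prod_pos fun p _ => hpos p
  rw [Finset.prod_inv_distrib] at h3
  simp only [Finset.prod_mul_distrib, Finset.prod_const, Finset.card_range] at h2
  have h4 : (symPoly u m).coeff k ≤ 2 ^ k * (∏ p ∈ Finset.range k, u p) *
      Real.exp (B * (k + p₀)) := by
    have h5 := h1.trans h2
    have h6 : 0 < (u k)⁻¹ ^ k := by positivity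
    refine le_of_mul_le_mul_right (h5.trans_eq ?_) h6
    ring
  refine h4.trans ?_
  rw [mul_pow, ← Real.exp_nat_mul, mul_add, Real.exp_add, le_div_iff₀ hM0]
  rw [le_inv_comm₀ hM0 h8] at h3
  calc 2 ^ k * (∏ p ∈ Finset.range k, u p) * (Real.exp (B * k) * Real.exp (B * p₀)) * M (s * k)
      ≤ 2 ^ k * (M (s * k))⁻¹ * (Real.exp (B * k) * Real.exp (B * p₀)) * M (s * k) := by gcongr
    _ = _ := by field_simp

end

/-- The sequence underlying the ultrapolynomials adapted to `M`. -/
theorem exists_symSeq {M : ℕ → ℝ} (hM : IsWeightSeq M) (hM2 : M2 M) (h2s : M2star M) :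
    ∃ (s : ℕ) (u : ℕ → ℝ), 4 ∣ s ∧ 0 < s ∧ (∀ p, 0 < u p) ∧ Summable u ∧
      (∃ K L : ℝ, 0 < K ∧ 0 < L ∧
        ∀ n (t : ℝ), |t| ^ n * Real.exp (-(symW u s t) / 8) ≤ K * L ^ n * M n) ∧
      ∃ K L : ℝ, 0 < K ∧ 0 < L ∧ ∀ n k, (symPoly u n).coeff k ≤ K * L ^ k / M (s * k) := by
  obtain ⟨p₀, N, hp₀, hN, h⟩ := h2s
  obtain ⟨C, H, h2⟩ := hM2
  have hw : ∀ p, p₀ ≤ p → 2 * wquot M (p - 1) ≤ wquot M (N * p - 1) := by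
    intro p hp
    have h1 : p - 1 + 1 = p := by omega
    have h3 : 0 < N * p := Nat.mul_pos hN (by omega)
    have h4 : N * p - 1 + 1 = N * p := by omega
    unfold wquot
    rw [h1, h4]; exact h p hp
  have hN2 : 2 ≤ N := by
    by_contra hlt
    have : N = 1 := by omega
    have h3 := hw p₀ le_rfl
    rw [this, one_mul] at h3
    have := wquot_pos hM (p₀ - 1)
    linarith
  set s := 8 * N with hsN
  have hs : 0 < s := by omega
  set u : ℕ → ℝ := fun p => 1 / wquot M (s * (p + p₀) - 1) ^ s with hudef
  have hu : ∀ p, u p = 1 / wquot M (s * (p + p₀) - 1) ^ s := fun p => rfl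
  have hpos := symSeq_pos hM hs hp₀ hu
  have hratio : ∀ k p, k ≤ p →
      u p / u k ≤ (N : ℝ) ^ 2 * ((k : ℝ) + p₀) ^ 2 * (1 / ((p : ℝ) + p₀)) ^ 2 := by
    intro k p hkp
    have hle : p₀ ≤ s * (k + p₀) := by nlinarith
    have := wquot_ratio hM hp₀ hN2 hw (x := s * (p + p₀)) (y := s * (k + p₀)) hle (by gcongr)
    have e1 : u p / u k = (wquot M (s * (k + p₀) - 1) / wquot M (s * (p + p₀) - 1)) ^ s := by
      rw [hu, hu, div_pow, div_div_div_eq, one_mul, mul_one]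
    rw [e1]
    refine this.trans_eq ?_
    have hs' : (s : ℝ) ≠ 0 := by exact_mod_cast hs.ne'
    push_cast
    rw [mul_div_mul_left _ _ hs', div_pow, one_div, inv_pow, div_eq_mul_inv, mul_assoc]
  have hB : ∀ k n, ∑ p ∈ Finset.Ico k n, u p / u k ≤ (2 * (N : ℝ) ^ 2) * (k + p₀) := by
    intro k n
    have hp₀' : (0 : ℝ) < p₀ := by exact_mod_cast hp₀
    have hk0 : (0 : ℝ) ≤ k := by positivity
    calc ∑ p ∈ Finset.Ico k n, u p / u k
        ≤ ∑ p ∈ Finset.Ico k n, (N : ℝ) ^ 2 * ((k : ℝ) + p₀) ^ 2 * (1 / ((p : ℝ) + p₀)) ^ 2 :=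
          Finset.sum_le_sum fun p hp => hratio k p (Finset.mem_Ico.1 hp).1
      _ = (N : ℝ) ^ 2 * ((k : ℝ) + p₀) ^ 2 * ∑ p ∈ Finset.Ico k n, (1 / ((p : ℝ) + p₀)) ^ 2 := by
          rw [Finset.mul_sum]
      _ ≤ (N : ℝ) ^ 2 * ((k : ℝ) + p₀) ^ 2 * (2 / ((k : ℝ) + p₀)) := by
          gcongr; exact sum_inv_sq_le p₀ n hp₀ k
      _ = _ := by field_simp
  have hsum : Summable u := by
    refine summable_of_sum_range_le (c := (2 * (N : ℝ) ^ 2) * ((0 : ℕ) + p₀) * u 0)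
      (fun p => (hpos p).le) fun n => ?_
    have := hB 0 n
    rw [← Finset.sum_div, div_le_iff₀ (hpos 0), Nat.Ico_zero_eq_range] at this
    exact this
  have he : Even s := ⟨4 * N, by omega⟩
  exact ⟨s, u, ⟨2 * N, by omega⟩, hs, hpos, hsum,
    exp_neg_symW_le hM hs hp₀ hu hsum h2 hN hsN he,
    symPoly_coeff_le hM hs hp₀ hu hB⟩

/-! ### Symbols on strips -/

lemma add_pow_le_perturb (s : ℕ) {ε : ℝ} (hε : 0 < ε) :
    ∃ C : ℝ, 0 ≤ C ∧ ∀ x y : ℝ, 0 ≤ x → 0 ≤ y → (x + y) ^ s ≤ (1 + ε) * x ^ s + C * y ^ s := by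
  have hcont : ContinuousAt (fun δ : ℝ => (1 + δ) ^ s) 0 := by fun_prop
  have hev : ∀ᶠ δ : ℝ in nhds 0, (1 + δ) ^ s < 1 + ε :=
    hcont.eventually_lt_const (by simpa using hε)
  obtain ⟨δ, hδ1, hδ⟩ : ∃ δ : ℝ, (1 + δ) ^ s < 1 + ε ∧ 0 < δ :=
    ((hev.filter_mono nhdsWithin_le_nhds).and
      (self_mem_nhdsWithin (a := (0 : ℝ)) (s := Set.Ioi 0))).exists
  refine ⟨(1 / δ + 1) ^ s, by positivity, fun x y hx hy => ?_⟩
  rcases le_total y (δ * x) with h | h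
  · have h1 : (x + y) ^ s ≤ ((1 + δ) * x) ^ s := by gcongr; linarith
    rw [mul_pow] at h1
    have h2 : (1 + δ) ^ s * x ^ s ≤ (1 + ε) * x ^ s := by gcongr
    have : 0 ≤ (1 / δ + 1) ^ s * y ^ s := by positivity
    linarith
  · have h1 : (x + y) ^ s ≤ ((1 / δ + 1) * y) ^ s := by
      gcongr
      have : x ≤ y / δ := by rw [le_div_iff₀ hδ]; linarith
      calc x + y ≤ y / δ + y := by linarith
        _ = _ := by ring
    rw [mul_pow] at h1
    have : 0 ≤ (1 + ε) * x ^ s := by positivity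
    linarith

lemma norm_add_pow_sub_le {R : Type*} [NormedCommRing R] [NormOneClass R] (x y : R) (s : ℕ) :
    ‖(x + y) ^ s - x ^ s‖ ≤ (‖x‖ + ‖y‖) ^ s - ‖x‖ ^ s := by
  induction s with
  | zero => simp
  | succ n ih =>
    have e1 : (x + y) ^ (n + 1) - x ^ (n + 1) = ((x + y) ^ n - x ^ n) * x + (x + y) ^ n * y := by
      ring
    rw [e1]
    calc _ ≤ ‖((x + y) ^ n - x ^ n) * x‖ + ‖(x + y) ^ n * y‖ := norm_add_le _ _
      _ ≤ ((‖x‖ + ‖y‖) ^ n - ‖x‖ ^ n) * ‖x‖ + (‖x‖ + ‖y‖) ^ n * ‖y‖ := by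
        gcongr
        · exact (norm_mul_le _ _).trans (by gcongr)
        · refine (norm_mul_le _ _).trans ?_
          gcongr
          exact (norm_pow_le _ _).trans (by gcongr; exact norm_add_le _ _)
      _ = _ := by ring

/-- On every horizontal strip `z ^ s` stays close to `(re z) ^ s`. -/
lemma strip_pow (s : ℕ) (he : Even s) (b : ℝ) (hb : 0 ≤ b) : ∃ C : ℝ, 0 ≤ C ∧ ∀ z : ℂ, |z.im| ≤ b →
    z.re ^ s / 2 - C ≤ (z ^ s).re := by
  obtain ⟨C, hC, h⟩ := add_pow_le_perturb s (ε := 1 / 2) (by norm_num)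
  refine ⟨C * b ^ s, by positivity, fun z hz => ?_⟩
  have h1 := norm_add_pow_sub_le (z.re : ℂ) (z.im * Complex.I) s
  rw [Complex.re_add_im] at h1
  simp only [norm_mul, Complex.norm_I, mul_one, Complex.norm_real, Real.norm_eq_abs] at h1
  have h2 := h |z.re| |z.im| (abs_nonneg _) (abs_nonneg _)
  have h3 : |z.im| ^ s ≤ b ^ s := by gcongr
  have h4 := (Complex.abs_re_le_norm _).trans h1
  rw [Complex.sub_re, ← Complex.ofReal_pow, Complex.ofReal_re, he.pow_abs] at h4
  rw [he.pow_abs z.re] at h2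
  have := (abs_le.1 h4).1
  have h5 := mul_le_mul_of_nonneg_left h3 hC
  linarith

section

variable {u : ℕ → ℝ} {s : ℕ} (hpos : ∀ p, 0 < u p) (hsum : Summable u) (he : Even s)
include hpos hsum he

omit hsum in
lemma symW_nonneg (t : ℝ) : 0 ≤ symW u s t :=
  tsum_nonneg fun p => Real.log_nonneg (by
    have := mul_nonneg (hpos p).le (he.pow_nonneg t); linarith)

lemma symW_le (t : ℝ) : symW u s t ≤ (∑' p, u p) * t ^ s := by
  rw [← tsum_mul_right]
  refine (symW_summable hpos hsum (he.pow_nonneg t)).tsum_le_tsum (fun p => ?_) (hsum.mul_right _)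
  have h0 : 0 ≤ u p * t ^ s := mul_nonneg (hpos p).le (he.pow_nonneg t)
  have := Real.log_le_sub_one_of_pos (x := 1 + u p * t ^ s) (by linarith)
  linarith

lemma symW_add_le {ε : ℝ} (hε : 0 < ε) : ∃ C : ℝ, 0 ≤ C ∧ ∀ x t : ℝ,
    symW u s (x + t) ≤ (1 + ε) * symW u s x + C * t ^ s := by
  obtain ⟨C, hC, h⟩ := add_pow_le_perturb s hε
  refine ⟨C * ∑' p, u p, mul_nonneg hC (tsum_nonneg fun p => (hpos p).le), fun x t => ?_⟩
  have e1 : (1 + ε) * symW u s x + C * (∑' p, u p) * t ^ s =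
      ∑' p, ((1 + ε) * Real.log (1 + u p * x ^ s) + u p * (C * t ^ s)) := by
    rw [((symW_summable hpos hsum (he.pow_nonneg x)).mul_left _).tsum_add (hsum.mul_right _),
      tsum_mul_left, tsum_mul_right, symW]
    ring
  rw [e1]
  refine (symW_summable hpos hsum (he.pow_nonneg _)).tsum_le_tsum (fun p => ?_)
    (((symW_summable hpos hsum (he.pow_nonneg x)).mul_left _).add (hsum.mul_right _))
  have hu := hpos p
  have hx := he.pow_nonneg x
  have ht := he.pow_nonneg t
  have hxt := he.pow_nonneg (x + t)
  have h1 : (x + t) ^ s ≤ (1 + ε) * x ^ s + C * t ^ s := by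
    have := h |x| |t| (abs_nonneg _) (abs_nonneg _)
    rw [he.pow_abs, he.pow_abs] at this
    refine le_trans ?_ this
    rw [← he.pow_abs]
    gcongr
    exact abs_add_le _ _
  have hux : 0 ≤ u p * x ^ s := by positivity
  have hut : 0 ≤ u p * (C * t ^ s) := by positivity
  have h2 : 1 + (1 + ε) * (u p * x ^ s) ≤ (1 + u p * x ^ s) ^ (1 + ε) :=
    one_add_mul_self_le_rpow_one_add (by linarith) (by linarith)
  have h3 : 1 + u p * (x + t) ^ s ≤ (1 + u p * x ^ s) ^ (1 + ε) * Real.exp (u p * (C * t ^ s)) := by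
    have h4 := Real.add_one_le_exp (u p * (C * t ^ s))
    calc 1 + u p * (x + t) ^ s ≤ 1 + u p * ((1 + ε) * x ^ s + C * t ^ s) := by gcongr
      _ ≤ (1 + (1 + ε) * (u p * x ^ s)) * (u p * (C * t ^ s) + 1) := by
        have : 0 ≤ (1 + ε) * (u p * x ^ s) * (u p * (C * t ^ s)) := by positivity
        linarith
      _ ≤ _ := by gcongr
  have h5 := Real.log_le_log (by positivity) h3
  rwa [Real.log_mul (by positivity) (Real.exp_pos _).ne', Real.log_exp,
    Real.log_rpow (by positivity)] at h5

lemma abs_symW_add_sub_le {ε : ℝ} (hε : 0 < ε) : ∃ C : ℝ, 0 ≤ C ∧ ∀ x t : ℝ,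
    |symW u s (x + t) - symW u s x| ≤ ε * symW u s x + C * t ^ s := by
  obtain ⟨C, hC, h⟩ := symW_add_le hpos hsum he hε
  refine ⟨C, hC, fun x t => abs_le.2 ⟨?_, by have := h x t; linarith⟩⟩
  have h1 := h (x + t) (-t)
  rw [add_neg_cancel_right, he.neg_pow] at h1
  have h2 := symW_nonneg hpos he x
  have h3 := mul_nonneg hC (he.pow_nonneg t)
  have h4 := symW_nonneg hpos he (x + t)
  by_contra! hlt
  have h5 : symW u s (x + t) < (1 - ε) * symW u s x - C * t ^ s := by linarith
  have h6 := mul_lt_mul_of_pos_left h5 (show 0 < 1 + ε by linarith)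
  nlinarith [mul_nonneg hε.le h3, mul_nonneg (sq_nonneg ε) h2]

lemma symW_measurable : Measurable (symW u s) := by
  refine measurable_of_tendsto_metrizable (f := fun n t => ∑ p ∈ Finset.range n,
    Real.log (1 + u p * t ^ s)) (fun n => ?_) ?_
  · exact Finset.measurable_fun_sum _ fun p _ => Real.measurable_log.comp (by fun_prop)
  · exact tendsto_pi_nhds.2 fun t =>
      (symW_summable hpos hsum (he.pow_nonneg t)).hasSum.tendsto_sum_nat

/-- The partial products of `∏ (1 + u_p z ^ s)` -/
def symProd (u : ℕ → ℝ) (s n : ℕ) (z : ℂ) : ℂ := ∏ p ∈ Finset.range n, (1 + u p * z ^ s)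

omit he in
lemma exists_symProd_limit : ∃ P : ℂ → ℂ, Differentiable ℂ P ∧
    ∀ z, Tendsto (fun n => symProd u s n z) atTop (nhds (P z)) := by
  refine ⟨fun z => ∏' p, (1 + (u p : ℂ) * z ^ s), ?_, ?_⟩
  · intro z₀
    have h1 : HasProdLocallyUniformlyOn (fun p (z : ℂ) => 1 + (u p : ℂ) * z ^ s)
        (fun z => ∏' p, (1 + (u p : ℂ) * z ^ s)) (Metric.ball z₀ 1) := by
      refine Summable.hasProdLocallyUniformlyOn_nat_one_add (f := fun p (z : ℂ) => (u p : ℂ) * z ^ s)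
        Metric.isOpen_ball (hsum.mul_right ((‖z₀‖ + 1) ^ s)) (.of_forall fun p z hz => ?_)
        fun p => by fun_prop
      rw [norm_mul, norm_pow, Complex.norm_real, Real.norm_of_nonneg (hpos p).le]
      have := (hpos p).le
      gcongr
      have h2 := norm_le_norm_add_norm_sub' z z₀
      have h3 := mem_ball_iff_norm.1 hz
      linarith
    exact ((hasProdLocallyUniformlyOn_iff_tendstoLocallyUniformlyOn.1 h1).differentiableOn
      (.of_forall fun t => by fun_prop) Metric.isOpen_ball).differentiableAt
      (Metric.ball_mem_nhds _ one_pos)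
  · intro z
    refine (Complex.multipliable_one_add_of_summable ?_).hasProd.tendsto_prod_nat
    refine Summable.of_norm ((hsum.mul_right (‖z‖ ^ s)).congr fun p => ?_)
    rw [norm_mul, norm_pow, Complex.norm_real, Real.norm_of_nonneg (hpos p).le]

omit hsum in
lemma le_norm_one_add {b C : ℝ} (hC : 0 ≤ C)
    (h : ∀ z : ℂ, |z.im| ≤ b → z.re ^ s / 2 - C ≤ (z ^ s).re) {p : ℕ} (hp : C * u p ≤ 1 / 2)
    {z : ℂ} (hz : |z.im| ≤ b) :
    Real.exp (Real.log (1 + u p * z.re ^ s) / 2 - 2 * (C * u p)) ≤ ‖1 + (u p : ℂ) * z ^ s‖ := by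
  have hu := hpos p
  have hx : 0 ≤ u p * z.re ^ s := mul_nonneg hu.le (he.pow_nonneg _)
  set X := u p * z.re ^ s
  set a := C * u p
  have ha : 0 ≤ a := mul_nonneg hC hu.le
  have h1 : 1 + X / 2 - a ≤ ‖1 + (u p : ℂ) * z ^ s‖ := by
    refine le_trans ?_ (Complex.re_le_norm _)
    rw [Complex.add_re, Complex.one_re, Complex.re_ofReal_mul]
    have := mul_le_mul_of_nonneg_left (h z hz) hu.le
    simp only [X, a]; linarith
  refine le_trans ?_ h1
  rw [sub_eq_add_neg, Real.exp_add]
  have h2 : Real.exp (Real.log (1 + X) / 2) ≤ 1 + X / 2 := by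
    refine le_of_pow_le_pow_left₀ two_ne_zero (by positivity) ?_
    rw [← Real.exp_nat_mul]
    have : ((2 : ℕ) : ℝ) * (Real.log (1 + X) / 2) = Real.log (1 + X) := by push_cast; ring
    rw [this, Real.exp_log (by positivity)]
    nlinarith [sq_nonneg X]
  have h3 : Real.exp (-(2 * a)) ≤ 1 - a := by
    rw [Real.exp_neg, inv_le_comm₀ (Real.exp_pos _) (by linarith)]
    have h4 := Real.add_one_le_exp (2 * a)
    refine le_trans ?_ h4
    rw [inv_le_iff_one_le_mul₀ (by linarith)]
    nlinarith
  calc _ ≤ (1 + X / 2) * (1 - a) := by gcongr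
    _ ≤ _ := by nlinarith

/-- The reciprocal of the infinite product on a strip. -/
theorem exists_symProd_inv {b C : ℝ} (hC : 0 ≤ C)
    (h : ∀ z : ℂ, |z.im| ≤ b → z.re ^ s / 2 - C ≤ (z ^ s).re) (hp : ∀ p, C * u p ≤ 1 / 2) :
    ∃ (R : ℂ → ℂ) (K : ℝ), DifferentiableOn ℂ R {z | |z.im| < b} ∧
      (∀ z : ℂ, |z.im| ≤ b → ‖R z‖ ≤ K * Real.exp (-(symW u s z.re) / 2)) ∧
      (∀ n, ∀ z : ℂ, |z.im| ≤ b → ‖symProd u s n z * R z‖ ≤ K) ∧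
      ∀ z : ℂ, |z.im| ≤ b → Tendsto (fun n => symProd u s n z * R z) atTop (nhds 1) := by
  obtain ⟨P, hP, hlim⟩ := exists_symProd_limit hpos hsum (s := s)
  set σ := ∑' p, u p
  have hstep : ∀ p, ∀ z : ℂ, |z.im| ≤ b →
      Real.exp (Real.log (1 + u p * z.re ^ s) / 2 - 2 * (C * u p)) ≤ ‖1 + (u p : ℂ) * z ^ s‖ :=
    fun p z hz => le_norm_one_add hpos he hC h (hp p) hz
  have hlow : ∀ z : ℂ, |z.im| ≤ b → Real.exp (symW u s z.re / 2 - 2 * C * σ) ≤ ‖P z‖ := by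
    intro z hz
    have h1 : Tendsto (fun n => Real.exp (∑ p ∈ Finset.range n,
        (Real.log (1 + u p * z.re ^ s) / 2 - 2 * (C * u p)))) atTop
        (nhds (Real.exp (symW u s z.re / 2 - 2 * C * σ))) := by
      refine (Real.continuous_exp.tendsto _).comp (HasSum.tendsto_sum_nat ?_)
      refine ((symW_summable hpos hsum (he.pow_nonneg _)).hasSum.div_const 2).sub ?_
      have := (hsum.hasSum.mul_left C).mul_left 2
      rwa [← mul_assoc] at this
    refine le_of_tendsto_of_tendsto' h1 (hlim z).norm fun n => ?_
    rw [Real.exp_sum, symProd, norm_prod]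
    exact Finset.prod_le_prod (fun p _ => (Real.exp_pos _).le) fun p _ => hstep p z hz
  have hne : ∀ z : ℂ, |z.im| ≤ b → P z ≠ 0 := fun z hz h0 => by
    have := hlow z hz
    rw [h0, norm_zero] at this
    exact this.not_gt (Real.exp_pos _)
  have hσ : 0 ≤ σ := tsum_nonneg fun p => (hpos p).le
  refine ⟨fun z => (P z)⁻¹, Real.exp (2 * C * σ), ?_, fun z hz => ?_, fun n z hz => ?_,
    fun z hz => ?_⟩
  · exact fun z hz => (hP z).differentiableWithinAt.inv (hne z (le_of_lt hz))
  · rw [norm_inv, ← Real.exp_add]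
    refine (inv_anti₀ (Real.exp_pos _) (hlow z hz)).trans ?_
    rw [← Real.exp_neg]
    exact Real.exp_le_exp.2 (by linarith)
  · rw [norm_mul, norm_inv, ← div_eq_mul_inv, div_le_iff₀ (norm_pos_iff.2 (hne z hz))]
    have : ∀ᶠ m in atTop, ‖symProd u s n z‖ ≤ Real.exp (2 * C * σ) * ‖symProd u s m z‖ := by
      filter_upwards [eventually_ge_atTop n] with m hm
      have h2 : Real.exp (-(2 * C * σ)) ≤ ∏ p ∈ Finset.Ico n m, ‖1 + (u p : ℂ) * z ^ s‖ := by
        calc Real.exp (-(2 * C * σ)) ≤ Real.exp (∑ p ∈ Finset.Ico n m, -(2 * C * u p)) := by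
              refine Real.exp_le_exp.2 ?_
              rw [Finset.sum_neg_distrib, ← Finset.mul_sum]
              have := hsum.sum_le_tsum (Finset.Ico n m) fun p _ => (hpos p).le
              gcongr
          _ ≤ _ := by
              rw [Real.exp_sum]
              refine Finset.prod_le_prod (fun p _ => (Real.exp_pos _).le) fun p _ =>
                le_trans (Real.exp_le_exp.2 ?_) (hstep p z hz)
              have := Real.log_nonneg (x := 1 + u p * z.re ^ s) (by
                have := mul_nonneg (hpos p).le (he.pow_nonneg z.re); linarith)
              linarith
      have h3 : ‖symProd u s m z‖ =
          ‖symProd u s n z‖ * ∏ p ∈ Finset.Ico n m, ‖1 + (u p : ℂ) * z ^ s‖ := by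
        rw [symProd, symProd, ← Finset.prod_range_mul_prod_Ico _ hm, norm_mul, norm_prod (Finset.Ico n m)]
      rw [h3]
      calc ‖symProd u s n z‖ = Real.exp (2 * C * σ) * (‖symProd u s n z‖ * Real.exp (-(2 * C * σ))) := by
            rw [mul_left_comm, ← Real.exp_add, add_neg_cancel, Real.exp_zero, mul_one]
        _ ≤ _ := by gcongr
    exact ge_of_tendsto ((hlim z).norm.const_mul _) this
  · have := (hlim z).mul_const (P z)⁻¹
    rwa [mul_inv_cancel₀ (hne z hz)] at this

end

lemma integrable_pow_mul_gaussian {c : ℝ} (hc : 0 < c) (s : ℕ) :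
    Integrable fun t : ℝ => t ^ s * Real.exp (-c * t ^ 2) := by
  have := integrable_rpow_mul_exp_neg_mul_sq hc (s := s)
    (lt_of_lt_of_le neg_one_lt_zero (Nat.cast_nonneg s))
  simpa only [Real.rpow_natCast] using this

section

variable {G : ℝ → ℝ} {s : ℕ} {σ : ℝ} (hG : Measurable G) (hG0 : ∀ t, 0 ≤ G t)
  (hGs : ∀ t, G t ≤ σ * t ^ s)
include hG hG0 hGs

lemma integrable_mul_exp_of_le (x : ℝ) :
    Integrable fun t : ℝ => G t * Real.exp (-t ^ 2) * Real.exp (x * t) := by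
  have h1 := ((integrable_pow_mul_gaussian (c := 1 / 2) (by norm_num) s).const_mul σ).mul_const
    (Real.exp (x ^ 2 / 2))
  refine h1.mono' (by fun_prop) (.of_forall fun t => ?_)
  have := hG0 t
  rw [Real.norm_of_nonneg (by positivity), mul_assoc, ← Real.exp_add, ← mul_assoc σ, mul_assoc (σ * _),
    ← Real.exp_add]
  refine mul_le_mul (hGs t) (Real.exp_le_exp.2 ?_) (Real.exp_pos _).le (this.trans (hGs t))
  nlinarith [sq_nonneg (t - x)]

/-- The density measure `G(t) exp(-t²) dt`. -/
lemma exists_gaussian_mean : ∃ g : ℂ → ℂ, Differentiable ℂ g ∧ ∀ z, g z =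
    ∫ t : ℝ, (G t : ℂ) * Complex.exp (-1 * t ^ 2 + (2 * z) * t + (-z ^ 2)) := by
  set ρ : ℝ → NNReal := fun t => Real.toNNReal (G t * Real.exp (-t ^ 2))
  have hρ : Measurable ρ := (hG.mul (by fun_prop)).real_toNNReal
  have hρ' : ∀ t, (ρ t : ℝ) = G t * Real.exp (-t ^ 2) := fun t =>
    Real.coe_toNNReal _ (mul_nonneg (hG0 t) (Real.exp_pos _).le)
  set ν : Measure ℝ := volume.withDensity fun t => (ρ t : ENNReal)
  have huniv : ProbabilityTheory.integrableExpSet id ν = Set.univ := by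
    refine Set.eq_univ_of_forall fun x => ?_
    change Integrable (fun t => Real.exp (x * id t)) ν
    rw [integrable_withDensity_iff_integrable_coe_smul hρ]
    simpa only [hρ', smul_eq_mul, id] using integrable_mul_exp_of_le hG hG0 hGs x
  refine ⟨fun z => Complex.exp (-z ^ 2) * ProbabilityTheory.complexMGF id ν (2 * z), ?_, fun z => ?_⟩
  · refine Differentiable.mul (by fun_prop) fun z => ?_
    have hd : DifferentiableAt ℂ (ProbabilityTheory.complexMGF id ν) (2 * z) :=
      (ProbabilityTheory.hasDerivAt_complexMGF (by rw [huniv]; simp)).differentiableAt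
    exact hd.comp z (by fun_prop)
  · change Complex.exp (-z ^ 2) * (∫ t, Complex.exp (2 * z * (id t : ℝ)) ∂ν) = _
    rw [integral_withDensity_eq_integral_smul hρ, ← integral_const_mul]
    refine integral_congr_ae (.of_forall fun t => ?_)
    simp only [NNReal.smul_def, hρ', Complex.real_smul, id]
    push_cast
    rw [Complex.exp_add, Complex.exp_add, neg_one_mul]
    ring

lemma integrable_gaussian_kernel (z : ℂ) : Integrable fun t : ℝ =>
    (G t : ℂ) * Complex.exp (-1 * t ^ 2 + (2 * z) * t + (-z ^ 2)) := by
  have h1 := (integrable_mul_exp_of_le hG hG0 hGs (2 * z).re).mul_const (Real.exp (-z ^ 2).re)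
  refine h1.mono' ?_ (.of_forall fun t => ?_)
  · exact (Complex.measurable_ofReal.comp hG).aestronglyMeasurable.mul (by fun_prop)
  · rw [norm_mul, Complex.norm_real, Real.norm_of_nonneg (hG0 t), Complex.norm_exp,
      mul_assoc (G t), mul_assoc (G t), ← Real.exp_add, ← Real.exp_add]
    refine le_of_eq ?_
    congr 2
    rw [Complex.add_re, Complex.add_re, Complex.re_mul_ofReal, ← Complex.ofReal_pow,
      Complex.re_mul_ofReal]
    simp

lemma gaussian_mean_sub (g : ℂ → ℂ) (hg : ∀ z, g z =
      ∫ t : ℝ, (G t : ℂ) * Complex.exp (-1 * t ^ 2 + (2 * z) * t + (-z ^ 2)))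
    (hdiff : ∀ ε : ℝ, 0 < ε → ∃ C : ℝ, 0 ≤ C ∧ ∀ x t : ℝ, |G (x + t) - G x| ≤ ε * G x + C * t ^ s)
    (b : ℝ) (ε : ℝ) (hε : 0 < ε) :
    ∃ K : ℝ, ∀ z : ℂ, |z.im| ≤ b → ‖g z - (Real.pi : ℂ) ^ (1 / 2 : ℂ) * G z.re‖ ≤ ε * G z.re + K := by
  set I₀ : ℝ := ∫ t : ℝ, Real.exp (-1 * t ^ 2) with hI₀
  set I₁ : ℝ := ∫ t : ℝ, t ^ s * Real.exp (-1 * t ^ 2) with hI₁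
  have hI₀pos : 0 < I₀ := by rw [hI₀, integral_gaussian]; positivity
  have hE := Real.exp_pos (b ^ 2)
  obtain ⟨C, hC, h⟩ := hdiff (ε / (Real.exp (b ^ 2) * I₀)) (by positivity)
  refine ⟨Real.exp (b ^ 2) * (C * I₁), fun z hz => ?_⟩
  have hint0 := integrable_cexp_quadratic' (b := -1) (by simp) (2 * z) (-z ^ 2)
  have h1 : (Real.pi : ℂ) ^ (1 / 2 : ℂ) * G z.re = ∫ t : ℝ, (G z.re : ℂ) *
      Complex.exp (-1 * t ^ 2 + (2 * z) * t + (-z ^ 2)) := by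
    rw [integral_const_mul, integral_cexp_quadratic (by simp)]
    have : (-z ^ 2 - (2 * z) ^ 2 / (4 * -1) : ℂ) = 0 := by ring
    rw [this, Complex.exp_zero, neg_neg, div_one, mul_one, mul_comm]
  rw [hg, h1, ← integral_sub (integrable_gaussian_kernel hG hG0 hGs z) (hint0.const_mul _)]
  set δ := ε / (Real.exp (b ^ 2) * I₀)
  have hi0 : Integrable fun t : ℝ => Real.exp (-1 * t ^ 2) := integrable_exp_neg_mul_sq one_pos
  have hi1 := integrable_pow_mul_gaussian one_pos s
  have hi2 : Integrable fun t : ℝ => Real.exp (b ^ 2) *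
      (δ * G z.re * Real.exp (-1 * t ^ 2) + C * (t ^ s * Real.exp (-1 * t ^ 2))) :=
    ((hi0.const_mul _).add (hi1.const_mul C)).const_mul _
  refine (norm_integral_le_of_norm_le (hi2.comp_sub_right z.re) (.of_forall fun t => ?_)).trans
    (le_of_eq ?_)
  · have h2 := h z.re (t - z.re)
    rw [add_sub_cancel] at h2
    rw [← sub_mul, norm_mul, ← Complex.ofReal_sub, Complex.norm_real, Real.norm_eq_abs,
      Complex.norm_exp]
    have h3 : (-1 * (t : ℂ) ^ 2 + 2 * z * t + -z ^ 2).re = z.im ^ 2 + -1 * (t - z.re) ^ 2 := by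
      rw [Complex.add_re, Complex.add_re, Complex.re_mul_ofReal, ← Complex.ofReal_pow,
        Complex.re_mul_ofReal]
      simp [pow_two]; ring
    have h4 : z.im ^ 2 ≤ b ^ 2 := sq_le_sq' (by linarith [(abs_le.1 hz).1]) (abs_le.1 hz).2
    rw [h3, Real.exp_add]
    calc _ ≤ (δ * G z.re + C * (t - z.re) ^ s) *
          (Real.exp (b ^ 2) * Real.exp (-1 * (t - z.re) ^ 2)) := by
          gcongr
          exact (abs_nonneg _).trans h2
      _ = _ := by ring
  · rw [integral_sub_right_eq_self (fun t : ℝ => Real.exp (b ^ 2) *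
      (δ * G z.re * Real.exp (-1 * t ^ 2) + C * (t ^ s * Real.exp (-1 * t ^ 2)))) z.re,
      integral_const_mul, integral_add (hi0.const_mul _) (hi1.const_mul C), integral_const_mul,
      integral_const_mul, ← hI₀, ← hI₁, mul_add]
    congr 1
    simp only [δ]; field_simp

end

/-- Holomorphic symbols factoring the reciprocal of the infinite product `∏ (1 + u_p z ^ s)`. -/
theorem exists_symbols {u : ℕ → ℝ} {s : ℕ} (hpos : ∀ p, 0 < u p) (hsum : Summable u) (he : Even s)
    {b C : ℝ} (hC : 0 ≤ C)
    (h : ∀ z : ℂ, |z.im| ≤ b → z.re ^ s / 2 - C ≤ (z ^ s).re) (hp : ∀ p, C * u p ≤ 1 / 2) :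
    ∃ f₁ f₂ : ℂ → ℂ, Differentiable ℂ f₁ ∧ DifferentiableOn ℂ f₂ {z | |z.im| < b} ∧
      (∀ B : ℝ, ∃ K, ∀ z : ℂ, |z.im| ≤ B → ‖f₁ z‖ ≤ K * Real.exp (-(symW u s z.re) / 8)) ∧
      (∃ K, ∀ z : ℂ, |z.im| ≤ b → ‖f₂ z‖ ≤ K * Real.exp (-(symW u s z.re) / 8)) ∧
      (∃ K, ∀ n, ∀ z : ℂ, |z.im| ≤ b → ‖symProd u s n z * (f₁ z * f₂ z)‖ ≤ K) ∧
      ∀ z : ℂ, |z.im| ≤ b → Tendsto (fun n => symProd u s n z * (f₁ z * f₂ z)) atTop (nhds 1) := by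
  obtain ⟨R, K, hR, hRb, hRK, hRl⟩ := exists_symProd_inv hpos hsum he hC h hp
  have hGm := symW_measurable hpos hsum he
  have hG0 := symW_nonneg hpos he
  have hGs := symW_le hpos hsum he
  obtain ⟨g, hgd, hg⟩ := exists_gaussian_mean hGm hG0 hGs
  set c : ℝ := Real.pi ^ (1 / 2 : ℝ) with hc
  have hc0 : 0 < c := by positivity
  have hcc : (Real.pi : ℂ) ^ (1 / 2 : ℂ) = (c : ℂ) := by
    rw [hc, Complex.ofReal_cpow Real.pi_pos.le]; norm_num
  have hre : ∀ B : ℝ, ∃ K, ∀ z : ℂ, |z.im| ≤ B →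
      |(g z / (4 * c)).re - symW u s z.re / 4| ≤ symW u s z.re / 8 + K := by
    intro B
    obtain ⟨K, hK⟩ := gaussian_mean_sub hGm hG0 hGs g hg
      (fun ε hε => abs_symW_add_sub_le hpos hsum he hε) B (c / 2) (by positivity)
    refine ⟨K / (4 * c), fun z hz => ?_⟩
    have h1 := (Complex.abs_re_le_norm _).trans (hK z hz)
    rw [hcc, Complex.sub_re, ← Complex.ofReal_mul, Complex.ofReal_re] at h1
    have h2 : (g z / (4 * c)).re = (g z).re / (4 * c) := by
      rw [show (4 * c : ℂ) = ((4 * c : ℝ) : ℂ) by push_cast; rfl, Complex.div_ofReal_re]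
    have h3 : (g z / (4 * c)).re - symW u s z.re / 4 =
        ((g z).re - c * symW u s z.re) / (4 * c) := by
      rw [h2]; field_simp
    rw [h3, abs_div, abs_of_pos (show 0 < 4 * c by positivity), div_le_iff₀ (by positivity)]
    refine h1.trans (le_of_eq ?_)
    field_simp; ring
  have hmul : ∀ z, Complex.exp (-(g z / (4 * c))) * (Complex.exp (g z / (4 * c)) * R z) = R z := by
    intro z
    rw [← mul_assoc, ← Complex.exp_add, neg_add_cancel, Complex.exp_zero, one_mul]
  refine ⟨fun z => Complex.exp (-(g z / (4 * c))), fun z => Complex.exp (g z / (4 * c)) * R z,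
    (hgd.div_const _).neg.cexp, (hgd.div_const _).cexp.differentiableOn.mul hR, fun B => ?_, ?_,
    ⟨K, fun n z hz => by rw [hmul]; exact hRK n z hz⟩, fun z hz => by
      simp only [hmul]; exact hRl z hz⟩
  · obtain ⟨A, hA⟩ := hre B
    refine ⟨Real.exp A, fun z hz => ?_⟩
    rw [Complex.norm_exp, ← Real.exp_add, Complex.neg_re]
    have := (abs_le.1 (hA z hz)).1
    exact Real.exp_le_exp.2 (by linarith)
  · obtain ⟨A, hA⟩ := hre b
    refine ⟨Real.exp A * K, fun z hz => ?_⟩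
    rw [norm_mul, Complex.norm_exp]
    have h1 := (abs_le.1 (hA z hz)).2
    have h2 := hRb z hz
    calc _ ≤ Real.exp (A + 3 * symW u s z.re / 8) * (K * Real.exp (-(symW u s z.re) / 2)) := by
          gcongr; linarith
      _ = Real.exp A * K * (Real.exp (3 * symW u s z.re / 8) * Real.exp (-(symW u s z.re) / 2)) := by
          rw [Real.exp_add]; ring
      _ = _ := by rw [← Real.exp_add]; ring_nf

/-! ### Fourier inversion on strips -/

/-- The inverse Fourier integral of (the restriction to `ℝ` of) a symbol. -/
def Fi (f : ℂ → ℂ) (x : ℝ) : ℂ := ∫ v : ℝ, Complex.exp (2 * Real.pi * x * v * Complex.I) * f v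

/-- Holomorphic functions on a strip with quadratic decay. -/
structure StripDec (b : ℝ) (f : ℂ → ℂ) (K : ℝ) : Prop where
  diff : DifferentiableOn ℂ f {z | |z.im| < b}
  bound : ∀ z : ℂ, |z.im| < b → ‖f z‖ * (1 + z.re ^ 2) ≤ K

namespace StripDec

variable {b K : ℝ} {f : ℂ → ℂ}

lemma norm_le (h : StripDec b f K) {z : ℂ} (hz : |z.im| < b) : ‖f z‖ ≤ K * (1 + z.re ^ 2)⁻¹ := by
  rw [← div_eq_mul_inv, le_div_iff₀ (by positivity)]
  exact h.bound z hz

lemma nonneg (h : StripDec b f K) (hb : 0 < b) : 0 ≤ K :=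
  le_trans (by positivity) (h.bound 0 (by simpa using hb))

lemma continuous_shift (h : StripDec b f K) {c : ℝ} (hc : |c| < b) :
    Continuous fun v : ℝ => f (v + c * Complex.I) := by
  refine h.diff.continuousOn.comp_continuous (by fun_prop) fun v => ?_
  simpa using hc

lemma integrable_shift (h : StripDec b f K) {c : ℝ} (hc : |c| < b) :
    Integrable fun v : ℝ => f (v + c * Complex.I) := by
  refine (integrable_inv_one_add_sq.const_mul K).mono'
    (h.continuous_shift hc).aestronglyMeasurable (.of_forall fun v => ?_)
  have := h.norm_le (z := v + c * Complex.I) (by simpa using hc)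
  simpa using this

lemma continuous_real (h : StripDec b f K) (hb : 0 < b) : Continuous fun v : ℝ => f v := by
  simpa using h.continuous_shift (c := 0) (by simpa using hb)

lemma integrable_real (h : StripDec b f K) (hb : 0 < b) : Integrable fun v : ℝ => f v := by
  simpa using h.integrable_shift (c := 0) (by simpa using hb)

lemma integral_shift (h : StripDec b f K) (hb : 0 < b) {c : ℝ} (hc : |c| < b) :
    ∫ v : ℝ, f v = ∫ v : ℝ, f (v + c * Complex.I) := by
  have hrect : ∀ T : ℝ, (∫ x : ℝ in (-T)..T, f x) - (∫ x : ℝ in (-T)..T, f (x + c * Complex.I)) +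
      (Complex.I * (∫ y : ℝ in (0 : ℝ)..c, f (T + y * Complex.I)) -
      Complex.I * (∫ y : ℝ in (0 : ℝ)..c, f ((-T : ℝ) + y * Complex.I))) = 0 := by
    intro T
    have := Complex.integral_boundary_rect_eq_zero_of_differentiableOn f ⟨-T, 0⟩ ⟨T, c⟩
      (h.diff.mono fun z hz => ?_)
    · simpa [add_sub_assoc] using this
    · have h2 : z.im ∈ Set.uIcc 0 c := hz.2
      have := Set.abs_sub_left_of_mem_uIcc h2
      simp only [sub_zero] at this
      exact this.trans_lt hc
  have hvert : ∀ T : ℝ, ‖Complex.I * ∫ y : ℝ in (0 : ℝ)..c, f (T + y * Complex.I)‖ ≤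
      K * (1 + T ^ 2)⁻¹ * |c| := by
    intro T
    rw [norm_mul, Complex.norm_I, one_mul]
    have := intervalIntegral.norm_integral_le_of_norm_le_const (a := 0) (b := c)
      (f := fun y : ℝ => f (T + y * Complex.I)) (C := K * (1 + T ^ 2)⁻¹) fun y hy => ?_
    · simpa using this
    · have hy' := Set.abs_sub_left_of_mem_uIcc (Set.uIoc_subset_uIcc hy)
      simp only [sub_zero] at hy'
      have := h.norm_le (z := T + y * Complex.I) (by simpa using hy'.trans_lt hc)
      simpa using this
  have hlim : Tendsto (fun T : ℝ => K * (1 + T ^ 2)⁻¹ * |c|) atTop (nhds 0) := by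
    have h1 : Tendsto (fun T : ℝ => 1 + T ^ 2) atTop atTop :=
      tendsto_atTop_add_const_left _ _ (tendsto_pow_atTop two_ne_zero)
    simpa using ((tendsto_inv_atTop_zero.comp h1).const_mul K).mul_const |c|
  have hv1 := squeeze_zero_norm hvert hlim
  have hv2 : Tendsto (fun T : ℝ => Complex.I * (∫ y : ℝ in (0 : ℝ)..c, f ((-T : ℝ) + y * Complex.I)))
      atTop (nhds 0) := by
    refine squeeze_zero_norm (fun T => ?_) hlim
    simpa using hvert (-T)
  have h1 := intervalIntegral_tendsto_integral (h.integrable_real hb) tendsto_neg_atTop_atBot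
    tendsto_id
  have h2 := intervalIntegral_tendsto_integral (h.integrable_shift hc) tendsto_neg_atTop_atBot
    tendsto_id
  have h3 := (h1.sub h2).add (hv1.sub hv2)
  have h4 := tendsto_nhds_unique (h3.congr fun T => hrect T) tendsto_const_nhds
  rw [sub_zero, add_zero] at h4
  exact sub_eq_zero.1 h4

/-- Inverse Fourier integrals of strip functions decay exponentially. -/
lemma norm_Fi_le (h : StripDec b f K) (hb : 0 < b) (x : ℝ) :
    ‖Fi f x‖ ≤ K * Real.pi * Real.exp (-(b * |x|)) := by
  set F : ℂ → ℂ := fun z => Complex.exp (2 * Real.pi * x * z * Complex.I) * f z with hF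
  have hexp : ∀ z : ℂ, ‖Complex.exp (2 * Real.pi * x * z * Complex.I)‖ =
      Real.exp (-(2 * Real.pi * x * z.im)) := by
    intro z
    rw [Complex.norm_exp]
    congr 1
    rw [show (2 * Real.pi * x * z * Complex.I : ℂ) =
      ((2 * Real.pi * x : ℝ) : ℂ) * (z * Complex.I) by push_cast; ring, Complex.re_ofReal_mul]
    simp
  have hS : StripDec b F (Real.exp (2 * Real.pi * |x| * b) * K) := by
    refine ⟨DifferentiableOn.mul (by fun_prop) h.diff, fun z hz => ?_⟩
    rw [norm_mul, hexp, mul_assoc]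
    refine mul_le_mul (Real.exp_le_exp.2 ?_) (h.bound z hz) (by positivity) (Real.exp_pos _).le
    have h1 : |x * z.im| ≤ |x| * b := by rw [abs_mul]; gcongr
    have h2 := (abs_le.1 h1).1
    have := mul_le_mul_of_nonneg_left h2 Real.two_pi_pos.le
    linarith
  obtain ⟨c, hc, hcx⟩ : ∃ c : ℝ, |c| < b ∧ b * |x| ≤ 2 * Real.pi * x * c := by
    have h3 := Real.pi_gt_three
    rcases le_total 0 x with hx | hx
    · refine ⟨b / 2, by rw [abs_of_pos (by positivity)]; linarith, ?_⟩
      rw [abs_of_nonneg hx]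
      nlinarith [mul_nonneg hb.le hx]
    · refine ⟨-(b / 2), by rw [abs_neg, abs_of_pos (by positivity)]; linarith, ?_⟩
      rw [abs_of_nonpos hx]
      nlinarith [mul_nonneg hb.le (neg_nonneg.2 hx)]
  have h1 : Fi f x = ∫ v : ℝ, F (v + c * Complex.I) := hS.integral_shift hb hc
  rw [h1]
  have h2 : ∀ v : ℝ, ‖F (v + c * Complex.I)‖ ≤ K * Real.exp (-(b * |x|)) * (1 + v ^ 2)⁻¹ := by
    intro v
    have h4 := h.norm_le (z := v + c * Complex.I) (by simpa using hc)
    rw [hF, norm_mul, hexp]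
    simp only [Complex.add_im, Complex.ofReal_im, Complex.mul_im, Complex.ofReal_re, Complex.I_im,
      mul_one, Complex.I_re, mul_zero, add_zero, zero_add, Complex.add_re, Complex.mul_re,
      sub_self] at h4 ⊢
    calc _ ≤ Real.exp (-(b * |x|)) * (K * (1 + v ^ 2)⁻¹) := by gcongr
      _ = _ := by ring
  refine (norm_integral_le_of_norm_le (integrable_inv_one_add_sq.const_mul _)
    (.of_forall h2)).trans (le_of_eq ?_)
  rw [integral_const_mul, integral_univ_inv_one_add_sq]
  ring

lemma mul_bounded (h : StripDec b f K) {g : ℂ → ℂ} {A : ℝ}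
    (hg : DifferentiableOn ℂ g {z | |z.im| < b}) (hgA : ∀ z : ℂ, |z.im| < b → ‖g z‖ ≤ A) :
    StripDec b (fun z => g z * f z) (A * K) := by
  refine ⟨hg.mul h.diff, fun z hz => ?_⟩
  rw [norm_mul, mul_assoc]
  exact mul_le_mul (hgA z hz) (h.bound z hz) (by positivity) ((norm_nonneg _).trans (hgA z hz))

lemma mono {b' : ℝ} (h : StripDec b f K) (hb : b' ≤ b) : StripDec b' f K :=
  ⟨h.diff.mono fun _ hz => lt_of_lt_of_le hz hb, fun z hz => h.bound z (hz.trans_le hb)⟩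

end StripDec

open scoped FourierTransform Convolution in
lemma Fi_eq_fourierInv (f : ℂ → ℂ) : Fi f = 𝓕⁻ (fun v : ℝ => f v) := by
  ext x
  rw [Real.fourierInv_eq', Fi]
  refine integral_congr_ae (.of_forall fun v => ?_)
  simp only [smul_eq_mul, RCLike.inner_apply, conj_trivial]
  push_cast
  ring_nf

lemma integrable_exp_neg_mul_abs {b : ℝ} (hb : 0 < b) : Integrable fun x : ℝ => Real.exp (-(b * |x|)) := by
  refine Integrable.mono' (g := fun x : ℝ => (2 / b ^ 2 + 1) * (1 + x ^ 2)⁻¹)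
    (integrable_inv_one_add_sq.const_mul _) (by fun_prop) (.of_forall fun x => ?_)
  rw [Real.norm_of_nonneg (Real.exp_pos _).le, Real.exp_neg, ← div_eq_mul_inv,
    le_div_iff₀ (by positivity), inv_mul_le_iff₀ (Real.exp_pos _)]
  have h1 := Real.quadratic_le_exp_of_nonneg (x := b * |x|) (by positivity)
  have h2 : 0 ≤ b * |x| := by positivity
  have h3 : (b * |x|) ^ 2 = b ^ 2 * x ^ 2 := by rw [mul_pow, sq_abs]
  rw [h3] at h1
  have h4 : 1 + b ^ 2 * x ^ 2 / 2 ≤ Real.exp (b * |x|) := by linarith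
  calc 1 + x ^ 2 ≤ (1 + b ^ 2 * x ^ 2 / 2) * (2 / b ^ 2 + 1) := by
        have : (1 + b ^ 2 * x ^ 2 / 2) * (2 / b ^ 2 + 1) =
          1 + x ^ 2 + 2 / b ^ 2 + b ^ 2 * x ^ 2 / 2 := by field_simp; ring
        rw [this]
        have : 0 ≤ 2 / b ^ 2 + b ^ 2 * x ^ 2 / 2 := by positivity
        linarith
    _ ≤ _ := by gcongr

namespace StripDec

variable {b K K' : ℝ} {f g : ℂ → ℂ}

open scoped FourierTransform Convolution

lemma continuous_Fi (h : StripDec b f K) (hb : 0 < b) : Continuous (Fi f) := by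
  refine continuous_of_dominated (bound := fun v : ℝ => ‖f v‖) (fun x => ?_)
    (fun x => .of_forall fun v => ?_) (h.integrable_real hb).norm (.of_forall fun v => by fun_prop)
  · exact AEStronglyMeasurable.mul (by fun_prop) (h.continuous_real hb).aestronglyMeasurable
  · rw [norm_mul, show (2 * Real.pi * x * v * Complex.I : ℂ) =
      ((2 * Real.pi * x * v : ℝ) : ℂ) * Complex.I by push_cast; rfl, Complex.norm_exp_ofReal_mul_I,
      one_mul]

lemma integrable_Fi (h : StripDec b f K) (hb : 0 < b) : Integrable (Fi f) := by
  refine ((integrable_exp_neg_mul_abs hb).const_mul (K * Real.pi)).mono'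
    (h.continuous_Fi hb).aestronglyMeasurable (.of_forall fun x => h.norm_Fi_le hb x)

lemma fourier_Fi (h : StripDec b f K) (hb : 0 < b) : 𝓕 (Fi f) = fun v : ℝ => f v := by
  rw [Fi_eq_fourierInv]
  refine Continuous.fourier_fourierInv_eq (h.continuous_real hb) (h.integrable_real hb) ?_
  have h1 := (h.integrable_Fi hb).comp_neg
  refine h1.congr (.of_forall fun x => ?_)
  simp only [Fi_eq_fourierInv, Real.fourierInv_eq_fourier_neg, neg_neg]

lemma convolution_Fi (hf : StripDec b f K) (hg : StripDec b g K') (hb : 0 < b) (z : ℝ) :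
    ∫ x : ℝ, Fi f x * Fi g (z - x) = Fi (fun w => f w * g w) z := by
  have hfi := hf.integrable_Fi hb
  have hgi := hg.integrable_Fi hb
  set h : ℝ → ℂ := (Fi f) ⋆[ContinuousLinearMap.mul ℂ ℂ] (Fi g) with hh
  have hF : 𝓕 h = fun v : ℝ => f v * g v := by
    ext v
    rw [hh, Real.fourier_mul_convolution_eq hfi hgi, hf.fourier_Fi hb, hg.fourier_Fi hb]
  have hc : Continuous h := by
    refine BddAbove.continuous_convolution_right_of_integrable _ ⟨K' * Real.pi, ?_⟩ hfi
      (hg.continuous_Fi hb)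
    rintro _ ⟨x, rfl⟩
    refine (hg.norm_Fi_le hb x).trans ?_
    have := mul_nonneg (hg.nonneg hb) Real.pi_pos.le
    exact mul_le_of_le_one_right this (Real.exp_le_one_iff.2 (by have := abs_nonneg x; nlinarith))
  have hint : Integrable h := hfi.integrable_convolution _ hgi
  have hfgi : Integrable fun v : ℝ => f v * g v := by
    refine (hf.integrable_real hb).mul_bdd (c := K') (hg.continuous_real hb).aestronglyMeasurable
      (.of_forall fun v => ?_)
    have h1 := hg.norm_le (z := v) (by simpa using hb)
    refine h1.trans (mul_le_of_le_one_right (hg.nonneg hb) (inv_le_one_of_one_le₀ ?_))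
    have := sq_nonneg (v : ℂ).re
    linarith
  have := congrFun (Continuous.fourierInv_fourier_eq hc hint (by rw [hF]; exact hfgi)) z
  rw [hF] at this
  rw [Fi_eq_fourierInv (fun w => f w * g w), this]
  rfl

lemma hasDerivAt_Fi (h : StripDec b f K) (h' : StripDec b (fun z => z * f z) K') (hb : 0 < b) (x : ℝ) :
    HasDerivAt (Fi f) (Fi (fun z => 2 * Real.pi * Complex.I * z * f z) x) x := by
  have hi := h'.integrable_real hb
  refine (hasDerivAt_integral_of_dominated_loc_of_deriv_le (𝕜 := ℝ) (μ := volume)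
    (F := fun (x : ℝ) (v : ℝ) => Complex.exp (2 * Real.pi * x * v * Complex.I) * f v)
    (F' := fun (x : ℝ) (v : ℝ) => Complex.exp (2 * Real.pi * x * v * Complex.I) *
      (2 * Real.pi * Complex.I * v * f v))
    (bound := fun v : ℝ => 2 * Real.pi * ‖v * f v‖) (s := Set.univ) Filter.univ_mem
    (.of_forall fun y => ?_) ?_ ?_ (.of_forall fun v y _ => ?_) (hi.norm.const_mul _)
    (.of_forall fun v y _ => ?_)).2
  · exact AEStronglyMeasurable.mul (by fun_prop) (h.continuous_real hb).aestronglyMeasurable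
  · refine (h.integrable_real hb).bdd_mul (c := 1) (by fun_prop) (.of_forall fun v => ?_)
    rw [show (2 * Real.pi * x * v * Complex.I : ℂ) =
      ((2 * Real.pi * x * v : ℝ) : ℂ) * Complex.I by push_cast; rfl, Complex.norm_exp_ofReal_mul_I]
  · exact AEStronglyMeasurable.mul (by fun_prop) (AEStronglyMeasurable.mul (by fun_prop)
      (h.continuous_real hb).aestronglyMeasurable)
  · rw [norm_mul, show (2 * Real.pi * y * v * Complex.I : ℂ) =
      ((2 * Real.pi * y * v : ℝ) : ℂ) * Complex.I by push_cast; rfl, Complex.norm_exp_ofReal_mul_I]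
    simp [abs_of_pos Real.pi_pos, mul_assoc]
  · have h1 : HasDerivAt (fun y : ℝ => (2 * Real.pi * y * v * Complex.I : ℂ))
        (2 * Real.pi * v * Complex.I) y := by
      have := (((Complex.ofRealCLM.hasDerivAt (x := y)).const_mul
        (2 * Real.pi : ℂ)).mul_const (v : ℂ)).mul_const Complex.I
      simpa using this
    have h2 := h1.cexp.mul_const (f v)
    refine h2.congr_deriv ?_
    ring

end StripDec

namespace StripDec

variable {b K : ℝ} {f : ℂ → ℂ}

lemma const_mul (h : StripDec b f K) (c : ℂ) : StripDec b (fun z => c * f z) (‖c‖ * K) :=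
  h.mul_bounded (differentiableOn_const c) fun _ _ => le_rfl

lemma sum {ι : Type*} (t : Finset ι) {f : ι → ℂ → ℂ} {K : ι → ℝ} (h : ∀ i ∈ t, StripDec b (f i) (K i)) :
    StripDec b (fun z => ∑ i ∈ t, f i z) (∑ i ∈ t, K i) := by
  refine ⟨DifferentiableOn.fun_sum fun i hi => (h i hi).diff, fun z hz => ?_⟩
  refine (mul_le_mul_of_nonneg_right (norm_sum_le _ _) (by positivity)).trans ?_
  rw [Finset.sum_mul]
  exact Finset.sum_le_sum fun i hi => (h i hi).bound z hz

end StripDec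

/-- The `n`-th derivative of the inverse Fourier integral of `f`, written on the symbol side. -/
def FiT (f : ℂ → ℂ) (n : ℕ) : ℝ → ℂ := Fi fun z => (2 * Real.pi * Complex.I * z) ^ n * f z

lemma FiT_zero (f : ℂ → ℂ) : FiT f 0 = Fi f := by simp [FiT]

lemma hasDerivAt_FiT {b : ℝ} (hb : 0 < b) {f : ℂ → ℂ}
    (h : ∀ n : ℕ, ∃ K, StripDec b (fun z => (2 * Real.pi * Complex.I * z) ^ n * f z) K) (n : ℕ) (x : ℝ) :
    HasDerivAt (FiT f n) (FiT f (n + 1) x) x := by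
  obtain ⟨K, hK⟩ := h n
  obtain ⟨K', hK'⟩ := h (n + 1)
  have hpi : (Real.pi : ℂ) ≠ 0 := by exact_mod_cast Real.pi_ne_zero
  have h2 := hK'.const_mul (2 * Real.pi * Complex.I)⁻¹
  have := hK.hasDerivAt_Fi (K' := ‖(2 * Real.pi * Complex.I : ℂ)⁻¹‖ * K') (by
    convert h2 using 2 with z
    rw [pow_succ]; field_simp) hb x
  refine this.congr_deriv ?_
  unfold FiT
  congr 1
  ext z
  ring

/-- Polynomial growth against an ultradifferentiable symbol. -/
lemma stripDec_pow_mul {M : ℕ → ℝ} (hM : IsWeightSeq M) {C H : ℝ} (h2 : HasM2 M C H) {W : ℝ → ℝ}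
    {K L : ℝ} (hL : 0 < L) (hK : 0 < K) (hKL : ∀ n (t : ℝ), |t| ^ n * Real.exp (-(W t) / 8) ≤ K * L ^ n * M n)
    {b A : ℝ} (hb : 0 < b) {f : ℂ → ℂ} (hf : DifferentiableOn ℂ f {z | |z.im| < b})
    (hA : ∀ z : ℂ, |z.im| < b → ‖f z‖ ≤ A * Real.exp (-(W z.re) / 8)) :
    ∃ K', 0 ≤ K' ∧ ∀ n : ℕ, StripDec b (fun z => (2 * Real.pi * Complex.I * z) ^ n * f z)
      (K' * (4 * Real.pi * L * H) ^ n * M n) := by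
  have hMp := hM.1
  obtain ⟨hC1, hH1, h2⟩ := h2
  have hA0 : 0 ≤ A := by
    have := (norm_nonneg _).trans (hA 0 (by simpa using hb))
    exact nonneg_of_mul_nonneg_left this (Real.exp_pos _)
  refine ⟨A * K * (1 + L ^ 2 * C * H ^ 2 * M 2 + Real.exp (W b / 8) * (K + K * L ^ 2 * M 2)), ?_,
    fun n => ⟨DifferentiableOn.mul (by fun_prop) hf, fun z hz => ?_⟩⟩
  · have := hMp 2; positivity
  set t := z.re
  set w := Real.exp (-(W t) / 8)
  have hw : 0 < w := Real.exp_pos _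
  have hz1 : ‖z‖ ≤ |t| + b := (Complex.norm_le_abs_re_add_abs_im z).trans (by gcongr)
  have hz2 : ‖z‖ ^ n ≤ 2 ^ n * (|t| ^ n + b ^ n) := by
    refine (pow_le_pow_left₀ (norm_nonneg _) hz1 n).trans ?_
    refine (add_pow_le (abs_nonneg t) hb.le n).trans ?_
    gcongr
    · norm_num
    · omega
  have e0 : w ≤ K := by simpa [hM.2.1] using hKL 0 t
  have e2 : t ^ 2 * w ≤ K * L ^ 2 * M 2 := by simpa [sq_abs] using hKL 2 t
  have en := hKL n t
  have en2 : |t| ^ n * t ^ 2 * w ≤ K * L ^ n * (L ^ 2 * C * H ^ 2 * M 2) * H ^ n * M n := by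
    have h1 := hKL (n + 2) t
    rw [pow_add, sq_abs] at h1
    refine h1.trans ?_
    calc K * L ^ (n + 2) * M (n + 2) ≤ K * L ^ (n + 2) * (C * H ^ (n + 2) * M n * M 2) := by
          gcongr; exact h2 n 2
      _ = _ := by ring
  have eb : b ^ n ≤ K * L ^ n * M n * Real.exp (W b / 8) := by
    have h1 := hKL n b
    rw [abs_of_pos hb, neg_div, Real.exp_neg, ← div_eq_mul_inv, div_le_iff₀ (Real.exp_pos _)] at h1
    exact h1
  have hMn := hMp n
  have hHn : 1 ≤ H ^ n := one_le_pow₀ hH1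
  have hX : 0 < K * L ^ n * M n := by positivity
  have key : (|t| ^ n + b ^ n) * (1 + t ^ 2) * w ≤ K * L ^ n * M n * H ^ n *
      (1 + L ^ 2 * C * H ^ 2 * M 2 + Real.exp (W b / 8) * (K + K * L ^ 2 * M 2)) := by
    have t1 : |t| ^ n * w ≤ K * L ^ n * M n * H ^ n := en.trans (le_mul_of_one_le_right hX.le hHn)
    have t2 : b ^ n * (w + t ^ 2 * w) ≤ K * L ^ n * M n * H ^ n *
        (Real.exp (W b / 8) * (K + K * L ^ 2 * M 2)) := by
      calc b ^ n * (w + t ^ 2 * w) ≤ K * L ^ n * M n * Real.exp (W b / 8) * (K + K * L ^ 2 * M 2) := by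
            have := hMp 2
            gcongr
        _ ≤ K * L ^ n * M n * Real.exp (W b / 8) * (K + K * L ^ 2 * M 2) * H ^ n := by
            have := hMp 2
            exact le_mul_of_one_le_right (by positivity) hHn
        _ = _ := by ring
    nlinarith [t1, t2, en2]
  have hn : ‖(2 * Real.pi * Complex.I * z) ^ n‖ = (2 * Real.pi) ^ n * ‖z‖ ^ n := by
    simp [abs_of_pos Real.pi_pos, mul_pow]
  rw [norm_mul, hn]
  calc (2 * Real.pi) ^ n * ‖z‖ ^ n * ‖f z‖ * (1 + t ^ 2)
      ≤ (2 * Real.pi) ^ n * (2 ^ n * (|t| ^ n + b ^ n)) * (A * w) * (1 + t ^ 2) := by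
        gcongr
        exact hA z hz
    _ = (4 * Real.pi) ^ n * A * ((|t| ^ n + b ^ n) * (1 + t ^ 2) * w) := by
        rw [show (4 * Real.pi) ^ n = (2 * Real.pi) ^ n * 2 ^ n by rw [← mul_pow]; congr 1; ring]
        ring
    _ ≤ (4 * Real.pi) ^ n * A * (K * L ^ n * M n * H ^ n *
      (1 + L ^ 2 * C * H ^ 2 * M 2 + Real.exp (W b / 8) * (K + K * L ^ 2 * M 2))) := by gcongr
    _ = _ := by rw [mul_pow (4 * Real.pi * L), mul_pow (4 * Real.pi)]; ring

/-! ### Gaussian symbols -/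

/-- The Gaussian symbol `exp (-π ε² z²)`. -/
def gsym (ε : ℝ) (z : ℂ) : ℂ := Complex.exp (-(Real.pi * ε ^ 2) * z ^ 2)

lemma Fi_gsym {ε : ℝ} (hε : 0 < ε) (x : ℝ) :
    Fi (gsym ε) x = ((ε⁻¹ * Real.exp (-Real.pi * (ε⁻¹ * x) ^ 2) : ℝ) : ℂ) := by
  have h := fourierIntegral_gaussian (b := (Real.pi * ε ^ 2 : ℂ)) (by
    rw [← Complex.ofReal_pow, ← Complex.ofReal_mul, Complex.ofReal_re]; positivity)
    (2 * Real.pi * x)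
  have h2 : Fi (gsym ε) x = ∫ v : ℝ, Complex.exp (Complex.I * (2 * Real.pi * x) * v) *
      Complex.exp (-(Real.pi * ε ^ 2 : ℂ) * v ^ 2) := by
    refine integral_congr_ae (.of_forall fun v => ?_)
    simp only [gsym]
    congr 2
    ring
  have hpi : (Real.pi : ℂ) ≠ 0 := by exact_mod_cast Real.pi_ne_zero
  have hε' : (ε : ℂ) ≠ 0 := by exact_mod_cast hε.ne'
  rw [h2, h, Complex.ofReal_mul, Complex.ofReal_exp]
  congr 1
  · rw [show (Real.pi / (Real.pi * ε ^ 2) : ℂ) = ((ε⁻¹ ^ 2 : ℝ) : ℂ) by push_cast; field_simp,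
      show (1 / 2 : ℂ) = ((1 / 2 : ℝ) : ℂ) by norm_num, ← Complex.ofReal_cpow (by positivity),
      ← Real.sqrt_eq_rpow, Real.sqrt_sq (by positivity)]
  · congr 1
    push_cast
    field_simp
    ring

lemma stripDec_gsym {ε : ℝ} (hε : 0 < ε) (b : ℝ) : ∃ K, StripDec b (gsym ε) K := by
  refine ⟨Real.exp (Real.pi * ε ^ 2 * b ^ 2) * (1 + (Real.pi * ε ^ 2)⁻¹), ?_, fun z hz => ?_⟩
  · unfold gsym
    fun_prop
  set a := Real.pi * ε ^ 2
  have ha : 0 < a := by positivity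
  have h1 : ‖gsym ε z‖ = Real.exp (a * z.im ^ 2) * Real.exp (-(a * z.re ^ 2)) := by
    rw [gsym, Complex.norm_exp, ← Real.exp_add,
      show (-(Real.pi * ε ^ 2) : ℂ) = ((-a : ℝ) : ℂ) by simp [a], Complex.re_ofReal_mul]
    congr 1
    simp [pow_two]; ring
  have h2 : z.im ^ 2 ≤ b ^ 2 := sq_le_sq' (by linarith [(abs_lt.1 hz).1]) (abs_lt.1 hz).2.le
  have h3 : Real.exp (-(a * z.re ^ 2)) * (1 + z.re ^ 2) ≤ 1 + a⁻¹ := by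
    rw [Real.exp_neg, inv_mul_le_iff₀ (Real.exp_pos _)]
    have h4 := Real.add_one_le_exp (a * z.re ^ 2)
    have h5 : (a * z.re ^ 2 + 1) * (1 + a⁻¹) = 1 + z.re ^ 2 + (a * z.re ^ 2 + a⁻¹) := by
      field_simp; ring
    have h6 : 0 ≤ a * z.re ^ 2 + a⁻¹ := by positivity
    calc 1 + z.re ^ 2 ≤ (a * z.re ^ 2 + 1) * (1 + a⁻¹) := by linarith
      _ ≤ _ := by gcongr
  rw [h1, mul_assoc]
  gcongr

/-- The one-dimensional Gaussian kernel of width `ε`. -/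
def gaussK (ε x : ℝ) : ℂ := ((ε⁻¹ * Real.exp (-Real.pi * (ε⁻¹ * x) ^ 2) : ℝ) : ℂ)

/-- One-dimensional data factoring the identity: `ψ 0 * θ 0 = χ 0`, and the ultradifferential
operators with coefficients `c n` applied to `χ 0` tend to the Dirac mass. The sequences `ψ`, `θ`,
`χ` list the successive derivatives of a function. -/
structure FactorData (M : ℕ → ℝ) (s : ℕ) (b ρ : ℝ) where
  c : ℕ → ℕ → ℝ
  ψ : ℕ → ℝ → ℂ
  θ : ℕ → ℝ → ℂ
  χ : ℕ → ℝ → ℂ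
  c_nonneg : ∀ n k, 0 ≤ c n k
  c_mono : ∀ k, Monotone fun n => c n k
  c_zero : ∀ n k, n < k → c n k = 0
  c_le : ∃ K, 0 < K ∧ ∀ n k, c n k ≤ K * ρ ^ k / M (s * k)
  ψ_deriv : ∀ n x, HasDerivAt (ψ n) (ψ (n + 1) x) x
  θ_deriv : ∀ n x, HasDerivAt (θ n) (θ (n + 1) x) x
  χ_deriv : ∀ n x, HasDerivAt (χ n) (χ (n + 1) x) x
  ψ_le : ∃ L, 0 < L ∧ ∀ B, 0 < B → ∃ K, 0 ≤ K ∧ ∀ n x, ‖ψ n x‖ ≤ K * L ^ n * M n * Real.exp (-(B * |x|))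
  θ_le : ∃ L, 0 < L ∧ ∃ K, 0 ≤ K ∧ ∀ n x, ‖θ n x‖ ≤ K * L ^ n * M n * Real.exp (-(b * |x|))
  χ_le : ∃ L, 0 < L ∧ ∃ K, 0 ≤ K ∧ ∀ n x, ‖χ n x‖ ≤ K * L ^ n * M n * Real.exp (-(b * |x|))
  conv : ∀ z, ∫ x : ℝ, ψ 0 x * θ 0 (z - x) = χ 0 z
  gauss_le : ∀ ε, 0 < ε → ∃ K, ∀ n z,
    ‖∫ x : ℝ, gaussK ε x * ∑ k ∈ Finset.range (n + 1), (c n k : ℂ) * χ (s * k) (z - x)‖ ≤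
      K * Real.exp (-(b * |z|))
  gauss_tendsto : ∀ ε, 0 < ε → ∀ z, Tendsto (fun n =>
    ∫ x : ℝ, gaussK ε x * ∑ k ∈ Finset.range (n + 1), (c n k : ℂ) * χ (s * k) (z - x)) atTop
      (nhds (gaussK ε z))

lemma symProd_eq_sum (u : ℕ → ℝ) {s : ℕ} (hs : 4 ∣ s) (n : ℕ) (z : ℂ) :
    symProd u s n z = ∑ k ∈ Finset.range (n + 1),
      (((symPoly u n).coeff k / (2 * Real.pi) ^ (s * k) : ℝ) : ℂ) *
        (2 * Real.pi * Complex.I * z) ^ (s * k) := by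
  have h1 : symProd u s n z = ((symPoly u n).map Complex.ofRealHom).eval (z ^ s) := by
    simp [symProd, symPoly, Polynomial.map_prod, Polynomial.eval_prod]
  rw [h1, Polynomial.eval_map, Polynomial.eval₂_eq_sum_range' _
    (Nat.lt_succ_of_le (symPoly_natDegree_le u n))]
  refine Finset.sum_congr rfl fun k _ => ?_
  have hI : Complex.I ^ (s * k) = 1 := by
    obtain ⟨m, rfl⟩ := hs
    rw [mul_assoc, pow_mul, Complex.I_pow_four, one_pow]
  have hpi : (2 * Real.pi : ℂ) ^ (s * k) ≠ 0 :=
    pow_ne_zero _ (mul_ne_zero two_ne_zero (by exact_mod_cast Real.pi_ne_zero))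
  have hz : (2 * Real.pi * Complex.I * z) ^ (s * k) = (2 * Real.pi : ℂ) ^ (s * k) * (z ^ s) ^ k := by
    rw [mul_pow, mul_pow _ Complex.I, hI, mul_one, pow_mul z]
  rw [hz, Complex.ofReal_div, Complex.ofReal_pow, Complex.ofReal_mul, Complex.ofReal_ofNat,
    Complex.ofRealHom_eq_coe, ← mul_assoc, div_mul_cancel₀ _ hpi]

theorem exists_factorData {M : ℕ → ℝ} (hM : IsWeightSeq M) (hM2 : M2 M) (h2s : M2star M) :
    ∃ s : ℕ, Even s ∧ ∀ b ρ : ℝ, 0 < b → 0 < ρ → Nonempty (FactorData M s b ρ) := by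
  obtain ⟨s, u₀, hs4, hs0, hu₀, hsum₀, ⟨K₁, L₁, hK₁, hL₁, hKL₁⟩, K₂, L₂, hK₂, hL₂, hKL₂⟩ :=
    exists_symSeq hM hM2 h2s
  obtain ⟨C₀, H, h2⟩ := hM2
  have hH : 1 ≤ H := h2.2.1
  have hMp := hM.1
  have he : Even s := by obtain ⟨m, rfl⟩ := hs4; exact ⟨2 * m, by ring⟩
  refine ⟨s, he, fun b ρ hb hρ => ?_⟩
  obtain ⟨A, hA, hstrip⟩ := strip_pow s he b hb.le
  -- scaling of the sequence
  obtain ⟨T, hT⟩ : ∃ T, ∀ p, u₀ p ≤ T := ⟨∑' p, u₀ p, fun p => hsum₀.le_tsum p fun q _ => (hu₀ q).le⟩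
  obtain ⟨μ, hμ, hμ1, hμ2⟩ : ∃ μ : ℝ, 0 < μ ∧ A * (T * μ ^ s) ≤ 1 / 2 ∧ L₂ * μ ^ s ≤ ρ := by
    have h0 : Tendsto (fun μ : ℝ => μ ^ s) (nhdsWithin 0 (Set.Ioi 0)) (nhds 0) := by
      have : Tendsto (fun μ : ℝ => μ ^ s) (nhds 0) (nhds (0 ^ s)) := (continuous_pow s).tendsto 0
      rw [zero_pow hs0.ne'] at this
      exact this.mono_left nhdsWithin_le_nhds
    have e1 : Tendsto (fun μ : ℝ => A * (T * μ ^ s)) (nhdsWithin 0 (Set.Ioi 0)) (nhds 0) := by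
      simpa using (h0.const_mul T).const_mul A
    have e2 : Tendsto (fun μ : ℝ => L₂ * μ ^ s) (nhdsWithin 0 (Set.Ioi 0)) (nhds 0) := by
      simpa using h0.const_mul L₂
    have := ((e1.eventually (gt_mem_nhds (show (0 : ℝ) < 1 / 2 by norm_num))).and
      ((e2.eventually (gt_mem_nhds hρ)).and self_mem_nhdsWithin)).exists
    obtain ⟨μ, h1, h2, h3⟩ := this
    exact ⟨μ, h3, h1.le, h2.le⟩
  set u : ℕ → ℝ := fun p => u₀ p * μ ^ s with hudef
  have hu : ∀ p, 0 < u p := fun p => mul_pos (hu₀ p) (pow_pos hμ _)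
  have hsum : Summable u := hsum₀.mul_right _
  have hW : ∀ n (t : ℝ), |t| ^ n * Real.exp (-(symW u s t) / 8) ≤ K₁ * (L₁ / μ) ^ n * M n := by
    intro n t
    rw [hudef, symW_scale, div_pow, mul_div_assoc', div_mul_eq_mul_div, le_div_iff₀ (by positivity)]
    have := hKL₁ n (μ * t)
    rw [abs_mul, abs_of_pos hμ, mul_pow] at this
    linarith
  obtain ⟨f₁, f₂, hd₁, hd₂, hf₁, ⟨A₂, hf₂⟩, ⟨A₃, hf₃⟩, hlim⟩ := exists_symbols hu hsum he hA hstrip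
    (fun p => le_trans (by have := hT p; simp only [hudef]; gcongr) hμ1)
  set L := L₁ / μ with hLdef
  have hL : 0 < L := by positivity
  set L' := 4 * Real.pi * L * H with hL'
  have hL'0 : 0 < L' := by positivity
  have hS₁ : ∀ B, 0 < B → ∃ K', 0 ≤ K' ∧ ∀ n : ℕ,
      StripDec B (fun z => (2 * Real.pi * Complex.I * z) ^ n * f₁ z) (K' * L' ^ n * M n) := by
    intro B hB
    obtain ⟨A₁, hA₁⟩ := hf₁ B
    exact stripDec_pow_mul hM h2 hL hK₁ hW hB hd₁.differentiableOn fun z hz => hA₁ z hz.le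
  obtain ⟨Kθ, hKθ, hS₂⟩ := stripDec_pow_mul hM h2 hL hK₁ hW hb hd₂ fun z hz => hf₂ z hz.le
  obtain ⟨Kχ, hKχ, hS₃⟩ := stripDec_pow_mul hM h2 hL hK₁ hW hb (f := fun z => f₁ z * f₂ z)
      (A := (hf₁ b).choose * A₂) (hd₁.differentiableOn.mul hd₂) fun z hz => by
    have h1 := (hf₁ b).choose_spec z hz.le
    have h2 := hf₂ z hz.le
    have h3 : Real.exp (-(symW u s z.re) / 8) ≤ 1 := by
      rw [Real.exp_le_one_iff]
      have := symW_nonneg hu he z.re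
      linarith
    have h4 : 0 ≤ (hf₁ b).choose := by
      have := (norm_nonneg _).trans h1
      exact nonneg_of_mul_nonneg_left this (Real.exp_pos _)
    have h5 : ‖f₁ z‖ ≤ (hf₁ b).choose := h1.trans (mul_le_of_le_one_right h4 h3)
    rw [norm_mul, mul_assoc]
    gcongr
  have hbd : ∀ {B Kz : ℝ} {f : ℂ → ℂ}, 0 < B →
      (∀ n : ℕ, StripDec B (fun z => (2 * Real.pi * Complex.I * z) ^ n * f z) (Kz * L' ^ n * M n)) →
      ∀ n x, ‖FiT f n x‖ ≤ Kz * Real.pi * L' ^ n * M n * Real.exp (-(B * |x|)) := by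
    intro B Kz f hB h n x
    refine ((h n).norm_Fi_le hB x).trans (le_of_eq ?_)
    ring
  set c : ℕ → ℕ → ℝ := fun n k => (symPoly u n).coeff k / (2 * Real.pi) ^ (s * k) with hc
  have hS : ∀ n, ∃ K, StripDec b (fun z => symProd u s n z * (f₁ z * f₂ z)) K := by
    intro n
    have h := StripDec.sum (Finset.range (n + 1)) fun k _ => (hS₃ (s * k)).const_mul (c n k : ℂ)
    have heq : (fun z => symProd u s n z * (f₁ z * f₂ z)) = fun z => ∑ k ∈ Finset.range (n + 1),
        (c n k : ℂ) * ((2 * Real.pi * Complex.I * z) ^ (s * k) * (f₁ z * f₂ z)) := by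
      ext z
      rw [symProd_eq_sum u hs4, Finset.sum_mul]
      exact Finset.sum_congr rfl fun k _ => mul_assoc _ _ _
    rw [heq]
    exact ⟨_, h⟩
  have hFi : ∀ n x, ∑ k ∈ Finset.range (n + 1), (c n k : ℂ) * FiT (fun z => f₁ z * f₂ z) (s * k) x =
      Fi (fun z => symProd u s n z * (f₁ z * f₂ z)) x := by
    intro n x
    have hi : ∀ k, Integrable fun v : ℝ => (c n k : ℂ) *
        (Complex.exp (2 * Real.pi * x * v * Complex.I) *
          ((2 * Real.pi * Complex.I * v) ^ (s * k) * (f₁ v * f₂ v))) := by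
      intro k
      refine (((hS₃ (s * k)).integrable_real hb).bdd_mul (c := 1) (by fun_prop)
        (.of_forall fun v => ?_)).const_mul _
      rw [show (2 * Real.pi * x * v * Complex.I : ℂ) =
        ((2 * Real.pi * x * v : ℝ) : ℂ) * Complex.I by push_cast; rfl, Complex.norm_exp_ofReal_mul_I]
    simp only [FiT, Fi]
    simp_rw [← integral_const_mul]
    rw [← integral_finsetSum _ fun k _ => hi k]
    refine integral_congr_ae (.of_forall fun v => ?_)
    simp only
    rw [symProd_eq_sum u hs4, Finset.sum_mul, Finset.mul_sum]
    refine Finset.sum_congr rfl fun k _ => ?_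
    ring
  have hconv : ∀ ε, 0 < ε → ∀ n z, ∫ x : ℝ, gaussK ε x * ∑ k ∈ Finset.range (n + 1), (c n k : ℂ) *
      FiT (fun z => f₁ z * f₂ z) (s * k) (z - x) =
      Fi (fun w => gsym ε w * (symProd u s n w * (f₁ w * f₂ w))) z := by
    intro ε hε n z
    obtain ⟨K, hK⟩ := hS n
    obtain ⟨K', hK'⟩ := stripDec_gsym hε b
    rw [← hK'.convolution_Fi hK hb]
    refine integral_congr_ae (.of_forall fun x => ?_)
    simp only
    rw [hFi, Fi_gsym hε, gaussK]
  refine ⟨⟨c, FiT f₁, FiT f₂, FiT fun z => f₁ z * f₂ z, fun n k => ?_, fun k => ?_, fun n k hnk => ?_,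
    ⟨K₂, hK₂, fun n k => ?_⟩, hasDerivAt_FiT hb fun n => ⟨_, (hS₁ b hb).choose_spec.2 n⟩,
    hasDerivAt_FiT hb fun n => ⟨_, hS₂ n⟩, hasDerivAt_FiT hb fun n => ⟨_, hS₃ n⟩,
    ⟨L', hL'0, fun B hB => ⟨(hS₁ B hB).choose * Real.pi, ?_, hbd hB (hS₁ B hB).choose_spec.2⟩⟩,
    ⟨L', hL'0, Kθ * Real.pi, by positivity, hbd hb hS₂⟩,
    ⟨L', hL'0, Kχ * Real.pi, by positivity, hbd hb hS₃⟩, fun z => ?_, fun ε hε => ?_, fun ε hε z => ?_⟩⟩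
  · exact div_nonneg (symPoly_coeff_nonneg hu n k) (by positivity)
  · intro m n hmn
    have := symPoly_coeff_mono hu k hmn
    simp only [hc]
    gcongr
  · simp only [hc]
    rw [Polynomial.coeff_eq_zero_of_natDegree_lt ((symPoly_natDegree_le u n).trans_lt hnk), zero_div]
  · have h1 : c n k ≤ (symPoly u n).coeff k := by
      refine div_le_self (symPoly_coeff_nonneg hu n k) (one_le_pow₀ ?_)
      have := Real.pi_gt_three
      linarith
    refine h1.trans ?_
    rw [hudef, symPoly_scale]
    have hMk := hMp (s * k)
    calc _ ≤ K₂ * L₂ ^ k / M (s * k) * (μ ^ s) ^ k := by gcongr; exact hKL₂ n k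
      _ = K₂ * (L₂ * μ ^ s) ^ k / M (s * k) := by rw [mul_pow]; ring
      _ ≤ _ := by gcongr
  · exact mul_nonneg (hS₁ B hB).choose_spec.1 Real.pi_pos.le
  · simp only [FiT_zero]
    have h1 := (hS₁ b hb).choose_spec.2 0
    have h2 := hS₂ 0
    simp only [pow_zero, one_mul] at h1 h2
    exact h1.convolution_Fi h2 hb z
  · obtain ⟨K, hK⟩ := stripDec_gsym hε b
    refine ⟨A₃ * K * Real.pi, fun n z => ?_⟩
    rw [hconv ε hε]
    obtain ⟨_, hSn⟩ := hS n
    have h1 := hK.mul_bounded hSn.diff fun z hz => hf₃ n z hz.le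
    simp_rw [mul_comm (gsym ε _)]
    exact h1.norm_Fi_le hb z
  · simp_rw [hconv ε hε]
    obtain ⟨K, hK⟩ := stripDec_gsym hε b
    have hexp : ∀ v : ℝ, ‖Complex.exp (2 * Real.pi * z * v * Complex.I)‖ = 1 := fun v => by
      rw [show (2 * Real.pi * z * v * Complex.I : ℂ) =
        ((2 * Real.pi * z * v : ℝ) : ℂ) * Complex.I by push_cast; rfl, Complex.norm_exp_ofReal_mul_I]
    rw [show gaussK ε z = Fi (gsym ε) z by rw [Fi_gsym hε, gaussK]]
    refine tendsto_integral_of_dominated_convergence (fun v : ℝ => ‖gsym ε v‖ * A₃) (fun n => ?_)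
      ((hK.integrable_real hb).norm.mul_const _) (fun n => .of_forall fun v => ?_)
      (.of_forall fun v => ?_)
    · obtain ⟨_, hSn⟩ := hS n
      exact AEStronglyMeasurable.mul (by fun_prop) (((hK.continuous_real hb).mul
        (hSn.continuous_real hb)).aestronglyMeasurable)
    · rw [norm_mul, hexp, one_mul, norm_mul]
      gcongr
      exact hf₃ n v (by simpa using hb.le)
    · have h1 := hlim v (by simpa using hb.le)
      have := (h1.const_mul (gsym ε v)).const_mul (Complex.exp (2 * Real.pi * z * v * Complex.I))
      simpa using this

/-! ### Families of iterated partial derivatives -/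

section MTower

variable {d : ℕ} {V : Type*} [NormedAddCommGroup V] [NormedSpace ℝ V]

/-- `G` lists all iterated partial derivatives of `G 0`. -/
def MTower (G : (Fin d → ℕ) → Rd d → V) : Prop :=
  ∀ α x, HasFDerivAt (G α)
    (∑ j, (EuclideanSpace.proj (𝕜 := ℝ) j : Rd d →L[ℝ] ℝ).smulRight (G (α + Pi.single j 1) x)) x

namespace MTower

variable {G : (Fin d → ℕ) → Rd d → V}

lemma dop_eq (h : MTower G) (j : Fin d) (α : Fin d → ℕ) : dop j (G α) = G (α + Pi.single j 1) := by
  ext x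
  rw [dop, (h α x).fderiv]
  simp

lemma dop_iterate (h : MTower G) (j : Fin d) (n : ℕ) (α : Fin d → ℕ) :
    (dop j)^[n] (G α) = G (α + Pi.single j n) := by
  induction n generalizing α with
  | zero => simp
  | succ n ih =>
    rw [Function.iterate_succ_apply, h.dop_eq, ih, add_assoc, ← Pi.single_add, add_comm 1 n]

lemma pD_eq (h : MTower G) (β : Fin d → ℕ) : pD β (G 0) = G β := by
  have key : ∀ l : List (Fin d), l.foldr (fun j g => (dop j)^[β j] g) (G 0) =
      G (l.map fun j => (Pi.single j (β j) : Fin d → ℕ)).sum := by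
    intro l
    induction l with
    | nil => simp
    | cons j l ih => rw [List.foldr_cons, ih, h.dop_iterate, List.map_cons, List.sum_cons, add_comm]
  rw [pD, key, ← List.ofFn_eq_map, List.sum_ofFn, Finset.univ_sum_single]

lemma contDiff (h : MTower G) (α : Fin d → ℕ) : ContDiff ℝ (⊤ : ℕ∞) (G α) := by
  rw [contDiff_infty]
  intro n
  induction n generalizing α with
  | zero =>
    exact contDiff_zero.2 (continuous_iff_continuousAt.2 fun x => (h α x).continuousAt)
  | succ n ih =>
    push_cast
    refine contDiff_succ_iff_hasFDerivAt.2 ⟨_, ?_, h α⟩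
    refine ContDiff.sum fun j _ => ?_
    exact (ContinuousLinearMap.smulRightL ℝ (Rd d) V (EuclideanSpace.proj j)).contDiff.comp (ih _)

lemma continuous (h : MTower G) (α : Fin d → ℕ) : Continuous (G α) := (h.contDiff α).continuous

lemma comp_clm (h : MTower G) {V' : Type*} [NormedAddCommGroup V'] [NormedSpace ℝ V'] (T : V →L[ℝ] V') :
    MTower fun α x => T (G α x) := by
  intro α x
  refine (T.hasFDerivAt.comp x (h α x)).congr_fderiv ?_
  ext v
  simp

end MTower

lemma contDiff_dop {f : Rd d → V} (hf : ContDiff ℝ (⊤ : ℕ∞) f) (j : Fin d) :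
    ContDiff ℝ (⊤ : ℕ∞) (dop j f) :=
  (hf.fderiv_right (m := (⊤ : ℕ∞)) (by simp)).clm_apply contDiff_const

lemma contDiff_dop_iterate {f : Rd d → V} (hf : ContDiff ℝ (⊤ : ℕ∞) f) (j : Fin d) (n : ℕ) :
    ContDiff ℝ (⊤ : ℕ∞) ((dop j)^[n] f) := by
  induction n with
  | zero => exact hf
  | succ n ih => rw [Function.iterate_succ_apply']; exact contDiff_dop ih j

lemma dop_comm {f : Rd d → V} (hf : ContDiff ℝ (⊤ : ℕ∞) f) (i j : Fin d) :
    dop i (dop j f) = dop j (dop i f) := by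
  have hd : ∀ x, DifferentiableAt ℝ (fderiv ℝ f) x := fun x =>
    ((hf.fderiv_right (m := 1) (by norm_cast)).differentiable (by simp)) x
  have h1 : ∀ (i j : Fin d) x, dop i (dop j f) x =
      fderiv ℝ (fderiv ℝ f) x (EuclideanSpace.single i 1) (EuclideanSpace.single j 1) := by
    intro i j x
    unfold dop
    rw [fderiv_clm_apply (hd x) (differentiableAt_const _)]
    simp
  ext x
  rw [h1, h1]
  exact (hf.contDiffAt.isSymmSndFDerivAt (by simp; norm_cast)) _ _

lemma dop_iterate_comm {f : Rd d → V} (hf : ContDiff ℝ (⊤ : ℕ∞) f) (i j : Fin d) (n : ℕ) :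
    dop i ((dop j)^[n] f) = (dop j)^[n] (dop i f) := by
  induction n with
  | zero => rfl
  | succ n ih =>
    rw [Function.iterate_succ_apply', dop_comm (contDiff_dop_iterate hf j n), ih,
      Function.iterate_succ_apply']

lemma contDiff_foldr_dop {f : Rd d → V} (hf : ContDiff ℝ (⊤ : ℕ∞) f) (α : Fin d → ℕ) (l : List (Fin d)) :
    ContDiff ℝ (⊤ : ℕ∞) (l.foldr (fun j g => (dop j)^[α j] g) f) := by
  induction l with
  | nil => exact hf
  | cons j l ih => exact contDiff_dop_iterate ih j _

lemma dop_pD {f : Rd d → V} (hf : ContDiff ℝ (⊤ : ℕ∞) f) (α : Fin d → ℕ) (i : Fin d) :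
    dop i (pD α f) = pD (α + Pi.single i 1) f := by
  have key : ∀ l : List (Fin d), l.Nodup →
      (i ∈ l → dop i (l.foldr (fun j g => (dop j)^[α j] g) f) =
        l.foldr (fun j g => (dop j)^[(α + Pi.single i 1 : Fin d → ℕ) j] g) f) ∧
      (i ∉ l → l.foldr (fun j g => (dop j)^[(α + Pi.single i 1 : Fin d → ℕ) j] g) f =
        l.foldr (fun j g => (dop j)^[α j] g) f) := by
    intro l hl
    induction l with
    | nil => simp
    | cons j l ih =>
      obtain ⟨hj, hl⟩ := List.nodup_cons.1 hl
      obtain ⟨ih1, ih2⟩ := ih hl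
      simp only [List.foldr_cons, List.mem_cons, not_or]
      refine ⟨fun hi => ?_, fun hi => ?_⟩
      · by_cases hij : i = j
        · subst hij
          rw [ih2 hj, ← Function.iterate_succ_apply' (dop i)]
          simp
        · rw [dop_iterate_comm (contDiff_foldr_dop hf α l), ih1 (hi.resolve_left hij)]
          simp [Pi.single_apply, Ne.symm hij]
      · rw [ih2 hi.2]
        simp [Ne.symm hi.1]
  exact (key _ (List.nodup_finRange d)).1 (List.mem_finRange i)

lemma ContDiff.mTower_pD {f : Rd d → V} (hf : ContDiff ℝ (⊤ : ℕ∞) f) : MTower fun α => pD α f := by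
  intro α x
  have h1 : DifferentiableAt ℝ (pD α f) x := (contDiff_foldr_dop hf α _).differentiable (by simp) x
  refine h1.hasFDerivAt.congr_fderiv ?_
  ext v
  have hv : v = ∑ j, v j • EuclideanSpace.single j (1 : ℝ) := by
    ext i
    simp [Pi.single_apply]
  conv_lhs => rw [hv]
  simp only [map_sum, map_smul, _root_.sum_apply, ContinuousLinearMap.smulRight_apply,
    PiLp.proj_apply, ← dop_pD hf]
  rfl

lemma pD_zero (f : Rd d → V) : pD (0 : Fin d → ℕ) f = f := by
  unfold pD
  induction List.finRange d with
  | nil => rfl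
  | cons j l ih => rw [List.foldr_cons, ih]; rfl

end MTower

/-! ### Tensor products -/

section Tensor

variable {d : ℕ}

/-- The function `x ↦ ∏ j, F (x j)`. -/
def tens (d : ℕ) (F : ℝ → ℂ) (x : Rd d) : ℂ := ∏ j, F (x j)

/-- The function `x ↦ ∏ j, F (α j) (x j)`. -/
def mtens (F : ℕ → ℝ → ℂ) (α : Fin d → ℕ) (x : Rd d) : ℂ := ∏ j, F (α j) (x j)

lemma mtens_zero (F : ℕ → ℝ → ℂ) : mtens F (0 : Fin d → ℕ) = tens d (F 0) := rfl

lemma mTower_mtens {F : ℕ → ℝ → ℂ} (hF : ∀ n x, HasDerivAt (F n) (F (n + 1) x) x) :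
    MTower (mtens F : (Fin d → ℕ) → Rd d → ℂ) := by
  intro α x
  have h1 : ∀ j : Fin d, HasFDerivAt (fun x : Rd d => F (α j) (x j))
      ((EuclideanSpace.proj (𝕜 := ℝ) j : Rd d →L[ℝ] ℝ).smulRight (F (α j + 1) (x j))) x := by
    intro j
    have := (hF (α j) (x j)).hasFDerivAt.comp x
      (EuclideanSpace.proj (𝕜 := ℝ) j : Rd d →L[ℝ] ℝ).hasFDerivAt
    refine this.congr_fderiv ?_
    ext v
    simp
  have h2 := HasFDerivAt.finsetProd (u := Finset.univ) fun j _ => h1 j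
  refine HasFDerivAt.congr_fderiv h2 ?_
  ext v
  simp only [_root_.sum_apply, _root_.smul_apply,
    ContinuousLinearMap.smulRight_apply]
  refine Finset.sum_congr rfl fun j _ => ?_
  rw [mtens, ← Finset.mul_prod_erase Finset.univ _ (Finset.mem_univ j)]
  have h3 : ∏ k ∈ Finset.univ.erase j, F ((α + Pi.single j 1 : Fin d → ℕ) k) (x k) =
      ∏ k ∈ Finset.univ.erase j, F (α k) (x k) :=
    Finset.prod_congr rfl fun k hk => by simp [Finset.ne_of_mem_erase hk]
  rw [h3]
  simp [mul_comm, mul_left_comm, mul_assoc]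

lemma norm_le_sum_abs (x : Rd d) : ‖x‖ ≤ ∑ j, |x j| := by
  rw [EuclideanSpace.norm_eq]
  refine Real.sqrt_le_iff.2 ⟨Finset.sum_nonneg fun j _ => abs_nonneg _, ?_⟩
  simpa using Finset.sum_sq_le_sq_sum_of_nonneg (s := Finset.univ) (f := fun j => |x j|)
    fun j _ => abs_nonneg _

lemma prod_exp_neg_le {B : ℝ} (hB : 0 ≤ B) (x : Rd d) :
    ∏ j, Real.exp (-(B * |x j|)) ≤ Real.exp (-(B * ‖x‖)) := by
  rw [← Real.exp_sum, Finset.sum_neg_distrib, ← Finset.mul_sum]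
  have := norm_le_sum_abs x
  gcongr

lemma norm_tens_le {F : ℝ → ℂ} {K B : ℝ} (hB : 0 ≤ B) (hK : 0 ≤ K)
    (h : ∀ x, ‖F x‖ ≤ K * Real.exp (-(B * |x|))) (x : Rd d) :
    ‖tens d F x‖ ≤ K ^ d * Real.exp (-(B * ‖x‖)) := by
  rw [tens, norm_prod]
  calc _ ≤ ∏ j, K * Real.exp (-(B * |x j|)) :=
        Finset.prod_le_prod (fun _ _ => norm_nonneg _) fun j _ => h _
    _ = K ^ d * ∏ j, Real.exp (-(B * |x j|)) := by simp [Finset.prod_mul_distrib]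
    _ ≤ _ := by gcongr; exact prod_exp_neg_le hB x

lemma norm_mtens_le {M : ℕ → ℝ} (hM : IsWeightSeq M) {F : ℕ → ℝ → ℂ} {K L B : ℝ} (hB : 0 ≤ B)
    (hK : 0 ≤ K) (hL : 0 ≤ L) (h : ∀ n x, ‖F n x‖ ≤ K * L ^ n * M n * Real.exp (-(B * |x|)))
    (α : Fin d → ℕ) (x : Rd d) :
    ‖mtens F α x‖ ≤ K ^ d * L ^ msize α * M (msize α) * Real.exp (-(B * ‖x‖)) := by
  have hMp := hM.1
  rw [mtens, norm_prod]
  calc _ ≤ ∏ j, K * L ^ α j * M (α j) * Real.exp (-(B * |x j|)) :=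
        Finset.prod_le_prod (fun _ _ => norm_nonneg _) fun j _ => h _ _
    _ = K ^ d * L ^ msize α * (∏ j, M (α j)) * ∏ j, Real.exp (-(B * |x j|)) := by
        simp [Finset.prod_mul_distrib, msize, Finset.prod_pow_eq_pow_sum]
    _ ≤ _ := by
        have h1 : ∏ j, M (α j) ≤ M (msize α) := M_prod_le hM _ _
        have h2 := prod_exp_neg_le hB x
        have h3 : 0 ≤ ∏ j, M (α j) := Finset.prod_nonneg fun j _ => (hMp _).le
        have h4 := (hMp (msize α)).le
        gcongr

lemma integral_tens_mul_tens (F G : ℝ → ℂ) (z : Rd d) :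
    ∫ x : Rd d, tens d F x * tens d G (z - x) = tens d (fun t => ∫ x : ℝ, F x * G (t - x)) z := by
  have h1 := (PiLp.volume_preserving_ofLp (Fin d)).integral_comp
    (MeasurableEquiv.toLp 2 (Fin d → ℝ)).symm.measurableEmbedding
    (fun y : Fin d → ℝ => ∏ j, F (y j) * G (z j - y j))
  have h2 := integral_fintype_prod_volume_eq_prod (𝕜 := ℂ) (ι := Fin d) (E := fun _ => ℝ)
    (f := fun j t => F t * G (z j - t))
  simp only [tens]
  rw [← h2, ← h1]
  refine integral_congr_ae (.of_forall fun x => ?_)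
  simp [Finset.prod_mul_distrib]

end Tensor

lemma integrable_exp_neg_norm (d : ℕ) {a : ℝ} (ha : 0 < a) :
    Integrable fun x : Rd d => Real.exp (-(a * ‖x‖)) := by
  have h1 : Integrable fun x : Rd d => (1 + ‖x‖) ^ (-((d + 1 : ℕ) : ℝ)) :=
    integrable_one_add_norm (by simp)
  refine (h1.const_mul (Real.exp a * (d + 1).factorial / a ^ (d + 1))).mono' (by fun_prop)
    (.of_forall fun x => ?_)
  have h2 := Real.pow_div_factorial_le_exp (x := a * (1 + ‖x‖)) (by positivity) (d + 1)
  rw [Real.norm_of_nonneg (Real.exp_pos _).le, Real.rpow_neg (by positivity), Real.rpow_natCast,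
    Real.exp_neg, ← div_eq_mul_inv, le_div_iff₀ (by positivity), inv_mul_le_iff₀ (Real.exp_pos _)]
  rw [div_le_iff₀ (by positivity), mul_pow, mul_add, mul_one, Real.exp_add] at h2
  rw [mul_div_assoc', le_div_iff₀ (by positivity)]
  linarith

/-- Continuous functions on `ℝ^d` with exponential decay of rate `b`. -/
def EDec {d : ℕ} (b : ℝ) (f : Rd d → ℂ) : Prop :=
  Continuous f ∧ ∃ K, 0 ≤ K ∧ ∀ x, ‖f x‖ ≤ K * Real.exp (-(b * ‖x‖))

/-- A continuous representation of `(ℝ^d, +)` of exponential growth. -/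
structure ExpRep {d : ℕ} {E : Type*} [NormedAddCommGroup E] [NormedSpace ℂ E]
    (π : Rd d → E →L[ℂ] E) (C κ : ℝ) : Prop where
  map_zero : π 0 = ContinuousLinearMap.id ℂ E
  map_add : ∀ x y : Rd d, π (x + y) = (π x).comp (π y)
  cont : Continuous fun p : Rd d × E => π p.1 p.2
  C_pos : 0 < C
  κ_pos : 0 < κ
  growth : ∀ (x : Rd d) (e : E), ‖π x e‖ ≤ C * Real.exp (κ * ‖x‖) * ‖e‖

namespace ExpRep

variable {d : ℕ} {E : Type*} [NormedAddCommGroup E] [NormedSpace ℂ E]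
  {π : Rd d → E →L[ℂ] E} {C κ b : ℝ} {f g : Rd d → ℂ}

lemma continuous_orbit (h : ExpRep π C κ) (e : E) : Continuous fun x => π x e :=
  h.cont.comp (Continuous.prodMk_left e)

lemma apply_comm (h : ExpRep π C κ) (x y : Rd d) (e : E) : π x (π y e) = π y (π x e) := by
  have h1 := h.map_add x y
  rw [add_comm, h.map_add y x] at h1
  exact (DFunLike.congr_fun h1 e).symm

lemma norm_smul_le (h : ExpRep π C κ) {K : ℝ} {x : Rd d} (hx : ‖f x‖ ≤ K * Real.exp (-(b * ‖x‖))) (e : E) :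
    ‖f x • π x e‖ ≤ K * C * ‖e‖ * Real.exp (-((b - κ) * ‖x‖)) := by
  rw [norm_smul]
  calc _ ≤ (K * Real.exp (-(b * ‖x‖))) * (C * Real.exp (κ * ‖x‖) * ‖e‖) := by
        have h0 := (norm_nonneg _).trans hx
        gcongr
        exact h.growth x e
    _ = K * C * ‖e‖ * (Real.exp (-(b * ‖x‖)) * Real.exp (κ * ‖x‖)) := by ring
    _ = _ := by rw [← Real.exp_add]; ring_nf

lemma integrable (h : ExpRep π C κ) (hb : κ < b) (hf : EDec b f) (e : E) :
    Integrable fun x => f x • π x e := by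
  obtain ⟨hc, K, -, hK⟩ := hf
  exact ((integrable_exp_neg_norm d (sub_pos.2 hb)).const_mul _).mono'
    (hc.smul (h.continuous_orbit e)).aestronglyMeasurable
    (.of_forall fun x => h.norm_smul_le (hK x) e)

variable [CompleteSpace E]

lemma norm_PiOp_le (h : ExpRep π C κ) (hb : κ < b) {K : ℝ} (hf : ∀ x, ‖f x‖ ≤ K * Real.exp (-(b * ‖x‖)))
    (e : E) :
    ‖PiOp π f e‖ ≤ K * (C * ∫ x : Rd d, Real.exp (-((b - κ) * ‖x‖))) * ‖e‖ := by
  refine (norm_integral_le_of_norm_le ((integrable_exp_neg_norm d (sub_pos.2 hb)).const_mul _)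
    (.of_forall fun x => h.norm_smul_le (hf x) e)).trans (le_of_eq ?_)
  rw [integral_const_mul]
  ring

lemma exists_PiOp_clm (h : ExpRep π C κ) (hb : κ < b) (hf : EDec b f) :
    ∃ T : E →L[ℂ] E, ∀ e, T e = PiOp π f e := by
  obtain ⟨K, -, hK⟩ := hf.2
  refine ⟨LinearMap.mkContinuous ⟨⟨PiOp π f, fun e e' => ?_⟩, fun c e => ?_⟩ _ (h.norm_PiOp_le hb hK),
    fun e => rfl⟩
  · simp only [PiOp, _root_.map_add, smul_add]
    exact integral_add (h.integrable hb hf e) (h.integrable hb hf e')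
  · simp only [PiOp, _root_.map_smul, smul_comm _ c, RingHom.id_apply]
    exact integral_smul c _

lemma apply_PiOp (h : ExpRep π C κ) (hb : κ < b) (hf : EDec b f) (x : Rd d) (e : E) :
    π x (PiOp π f e) = PiOp π f (π x e) := by
  rw [PiOp, ← (π x).integral_comp_comm (h.integrable hb hf e), PiOp]
  simp only [_root_.map_smul, h.apply_comm x]

lemma apply_PiOp_eq_integral (h : ExpRep π C κ) (hb : κ < b) (hf : EDec b f) (x : Rd d) (e : E) :
    π x (PiOp π f e) = ∫ y, f (y - x) • π y e := by
  rw [h.apply_PiOp hb hf, PiOp, ← integral_sub_right_eq_self _ x]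
  refine integral_congr_ae (.of_forall fun y => ?_)
  simp only
  rw [← ContinuousLinearMap.comp_apply, ← h.map_add, sub_add_cancel]

/-- `Π` turns convolution into composition. -/
lemma PiOp_PiOp (h : ExpRep π C κ) (hb : κ < b) (hf : EDec b f) (hg : EDec b g) (e : E) :
    PiOp π f (PiOp π g e) = PiOp π (fun z => ∫ x, f x * g (z - x)) e := by
  obtain ⟨Kf, hKf0, hKf⟩ := hf.2
  obtain ⟨Kg, hKg0, hKg⟩ := hg.2
  have ha := sub_pos.2 hb
  have hi : Integrable (Function.uncurry fun (x z : Rd d) => f x • g (z - x) • π z e)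
      (volume.prod volume) := by
    have h1 := (integrable_exp_neg_norm d ha).convolution_integrand (ContinuousLinearMap.mul ℝ ℝ)
      (integrable_exp_neg_norm d ha)
    refine (h1.swap.const_mul (Kf * Kg * C * ‖e‖)).mono' ?_ (.of_forall fun p => ?_)
    · refine Continuous.aestronglyMeasurable ?_
      have := hf.1
      have := hg.1
      have := h.continuous_orbit e
      fun_prop
    · obtain ⟨x, z⟩ := p
      simp only [Function.uncurry_apply_pair, Function.comp_apply, Prod.swap_prod_mk,
        ContinuousLinearMap.mul_apply', norm_smul]
      have hz : ‖z‖ ≤ ‖x‖ + ‖z - x‖ := by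
        have := norm_add_le x (z - x); rwa [add_sub_cancel] at this
      calc _ ≤ (Kf * Real.exp (-(b * ‖x‖))) * ((Kg * Real.exp (-(b * ‖z - x‖))) *
            (C * Real.exp (κ * (‖x‖ + ‖z - x‖)) * ‖e‖)) := by
            have hκ := h.κ_pos
            have hC := h.C_pos
            gcongr
            · exact hKf x
            · exact hKg _
            · exact (h.growth z e).trans (by gcongr)
        _ = Kf * Kg * C * ‖e‖ * (Real.exp (-(b * ‖x‖)) * Real.exp (-(b * ‖z - x‖)) *
            Real.exp (κ * (‖x‖ + ‖z - x‖))) := by ring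
        _ = _ := by
            simp only [← Real.exp_add]
            ring_nf
  calc PiOp π f (PiOp π g e) = ∫ x, ∫ z, f x • g (z - x) • π z e := by
        refine integral_congr_ae (.of_forall fun x => ?_)
        simp only
        rw [h.apply_PiOp_eq_integral hb hg, integral_smul]
    _ = ∫ z, ∫ x, f x • g (z - x) • π z e := integral_integral_swap hi
    _ = _ := by
        refine integral_congr_ae (.of_forall fun z => ?_)
        simp only [smul_smul]
        exact integral_smul_const _ _

end ExpRep

/-- Every member of the family has exponential decay of rate `b`. -/
def MDec {d : ℕ} (b : ℝ) (f : (Fin d → ℕ) → Rd d → ℂ) : Prop :=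
  ∀ α, ∃ K, 0 ≤ K ∧ ∀ x, ‖f α x‖ ≤ K * Real.exp (-(b * ‖x‖))

lemma msize_add_single {d : ℕ} (α : Fin d → ℕ) (j : Fin d) : msize (α + Pi.single j 1) = msize α + 1 := by
  simp [msize, Finset.sum_add_distrib]

section Partials

variable {ι Y V Z : Type*} [Fintype ι] [MeasurableSpace Y] {μ : Measure Y} [NormedAddCommGroup V]
  [NormedSpace ℝ V] [NormedAddCommGroup Z] [NormedSpace ℝ Z]

lemma integrable_sum_clm (T : ι → V →L[ℝ] Z) {f : ι → Y → V} (hf : ∀ j, Integrable (f j) μ) :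
    Integrable (fun y => ∑ j, T j (f j y)) μ :=
  integrable_finsetSum _ fun j _ => (T j).integrable_comp (hf j)

lemma integral_sum_clm [CompleteSpace V] [CompleteSpace Z] (T : ι → V →L[ℝ] Z) {f : ι → Y → V}
    (hf : ∀ j, Integrable (f j) μ) : ∫ y, ∑ j, T j (f j y) ∂μ = ∑ j, T j (∫ y, f j y ∂μ) := by
  rw [integral_finsetSum _ fun j _ => (T j).integrable_comp (hf j)]
  exact Finset.sum_congr rfl fun j _ => (T j).integral_comp_comm (hf j)

lemma hasFDerivAt_integral_of_partials [CompleteSpace V] {X : Type*} [NormedAddCommGroup X] [NormedSpace ℝ X]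
    (p : ι → X →L[ℝ] ℝ) {F : X → Y → V} {F' : ι → X → Y → V} {x : X} {B : ι → Y → ℝ}
    (hF : ∀ x', AEStronglyMeasurable (F x') μ) (hFx : Integrable (F x) μ)
    (hF' : ∀ j, AEStronglyMeasurable (F' j x) μ) (hB : ∀ j, Integrable (B j) μ)
    (hle : ∀ j y, ∀ x' ∈ Metric.ball x 1, ‖F' j x' y‖ ≤ B j y)
    (hd : ∀ y x', HasFDerivAt (fun x' => F x' y) (∑ j, (p j).smulRight (F' j x' y)) x') :
    HasFDerivAt (fun x => ∫ y, F x y ∂μ) (∑ j, (p j).smulRight (∫ y, F' j x y ∂μ)) x := by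
  have hi : ∀ j, Integrable (F' j x) μ := fun j => (hB j).mono' (hF' j)
    (.of_forall fun y => hle j y x (Metric.mem_ball_self one_pos))
  have hsum := integral_sum_clm (fun j => ContinuousLinearMap.smulRightL ℝ X V (p j)) hi
  have h1 : ∀ᵐ y ∂μ, ∀ x' ∈ Metric.ball x 1, ‖∑ j, (p j).smulRight (F' j x' y)‖ ≤ ∑ j, ‖p j‖ * B j y := by
    refine .of_forall fun y x' hx' => ?_
    refine (norm_sum_le _ _).trans (Finset.sum_le_sum fun j _ => ?_)
    rw [ContinuousLinearMap.norm_smulRight_apply]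
    exact mul_le_mul_of_nonneg_left (hle j y x' hx') (norm_nonneg _)
  have h2 : Integrable (fun y => ∑ j, ‖p j‖ * B j y) μ :=
    integrable_finsetSum _ fun j _ => (hB j).const_mul _
  have h3 := integrable_sum_clm (fun j => ContinuousLinearMap.smulRightL ℝ X V (p j)) hi
  refine HasFDerivAt.congr_fderiv (hasFDerivAt_integral_of_dominated_of_fderiv_le
    (Metric.ball_mem_nhds x one_pos) (.of_forall hF) hFx h3.aestronglyMeasurable h1 h2
    (.of_forall fun y x' _ => hd y x')) hsum

end Partials

namespace ExpRep

variable {d : ℕ} {E : Type*} [NormedAddCommGroup E] [NormedSpace ℂ E] [CompleteSpace E]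
  {π : Rd d → E →L[ℂ] E} {C κ b : ℝ} {f : (Fin d → ℕ) → Rd d → ℂ}

lemma hasFDerivAt_PiOp (h : ExpRep π C κ) (hb : κ < b) (hf : MTower f) (hd : MDec b f) (e : E)
    (α : Fin d → ℕ) (x : Rd d) :
    HasFDerivAt (fun x => π x (PiOp π (f α) e))
      (∑ j, (EuclideanSpace.proj (𝕜 := ℝ) j : Rd d →L[ℝ] ℝ).smulRight
        (-(π x (PiOp π (f (α + Pi.single j 1)) e)))) x := by
  have hE : ∀ β, EDec b (f β) := fun β => ⟨hf.continuous β, hd β⟩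
  have hb0 : 0 < b := h.κ_pos.trans hb
  choose K hK0 hK using hd
  have ho := h.continuous_orbit e
  have hbnd : ∀ β x' y, dist x' x < 1 → ‖f β (y - x') • π y e‖ ≤
      K β * Real.exp (b * (‖x‖ + 1)) * C * ‖e‖ * Real.exp (-((b - κ) * ‖y‖)) := by
    intro β x' y hx'
    refine h.norm_smul_le (f := fun y => f β (y - x')) ((hK β _).trans ?_) e
    rw [mul_assoc, ← Real.exp_add]
    have h1 : ‖y‖ ≤ ‖y - x'‖ + (‖x‖ + 1) := by
      have e1 := norm_add_le (y - x') x'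
      have e2 := norm_add_le (x' - x) x
      rw [sub_add_cancel] at e1 e2
      rw [dist_eq_norm] at hx'
      linarith
    refine mul_le_mul_of_nonneg_left (Real.exp_le_exp.2 ?_) (hK0 β)
    nlinarith
  have hi : ∀ β, Integrable fun y : Rd d => K β * Real.exp (b * (‖x‖ + 1)) * C * ‖e‖ *
      Real.exp (-((b - κ) * ‖y‖)) := fun β =>
    (integrable_exp_neg_norm d (sub_pos.2 hb)).const_mul _
  have hm : ∀ β x', AEStronglyMeasurable (fun y => f β (y - x') • π y e) volume := fun β x' =>
    (((hf.continuous β).comp (continuous_id.sub continuous_const)).smul ho).aestronglyMeasurable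
  have key := hasFDerivAt_integral_of_partials (μ := volume)
    (fun j => (EuclideanSpace.proj (𝕜 := ℝ) j : Rd d →L[ℝ] ℝ)) (F := fun x y => f α (y - x) • π y e)
    (F' := fun j x y => -(f (α + Pi.single j 1) (y - x) • π y e)) (x := x)
    (B := fun j y => K (α + Pi.single j 1) * Real.exp (b * (‖x‖ + 1)) * C * ‖e‖ *
      Real.exp (-((b - κ) * ‖y‖)))
    (hm α) ((hi α).mono' (hm α x) (.of_forall fun y => hbnd α x y (by simp)))
    (fun j => (hm _ x).neg) (fun j => hi _)
    (fun j y x' hx' => by rw [norm_neg]; exact hbnd _ x' y hx') (fun y x' => ?_)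
  · simp only [h.apply_PiOp_eq_integral hb (hE _)]
    simpa only [integral_neg] using key
  · have h1 := ((hf α (y - x')).comp x' ((hasFDerivAt_id x').const_sub y)).smul_const (π y e)
    refine h1.congr_fderiv ?_
    ext v
    simp [Finset.sum_smul, ← smul_assoc]

/-- The iterated derivatives of the orbit map of `Π(f)e`. -/
lemma mTower_PiOp (h : ExpRep π C κ) (hb : κ < b) (hf : MTower f) (hd : MDec b f) (e : E) :
    MTower fun α x => ((-1 : ℝ) ^ msize α) • π x (PiOp π (f α) e) := by
  intro α x
  refine ((h.hasFDerivAt_PiOp hb hf hd e α x).const_smul ((-1 : ℝ) ^ msize α)).congr_fderiv ?_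
  ext v
  simp only [_root_.smul_apply, _root_.sum_apply, Finset.smul_sum, ContinuousLinearMap.smulRight_apply]
  refine Finset.sum_congr rfl fun j _ => ?_
  rw [msize_add_single, pow_succ, mul_neg_one, neg_smul, smul_neg, smul_neg, smul_comm]
  simp

lemma orbit_PiOp_eq (e : E) :
    orbit π (PiOp π (f 0) e) = (fun α x => ((-1 : ℝ) ^ msize α) • π x (PiOp π (f α) e)) 0 := by
  ext x
  simp [orbit, msize]

lemma contDiff_orbit_PiOp (h : ExpRep π C κ) (hb : κ < b) (hf : MTower f) (hd : MDec b f) (e : E) :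
    ContDiff ℝ (⊤ : ℕ∞) (orbit π (PiOp π (f 0) e)) := by
  rw [orbit_PiOp_eq]
  exact (h.mTower_PiOp hb hf hd e).contDiff 0

lemma pD_orbit_PiOp (h : ExpRep π C κ) (hb : κ < b) (hf : MTower f) (hd : MDec b f) (e : E)
    (α : Fin d → ℕ) :
    pD α (orbit π (PiOp π (f 0) e)) 0 = ((-1 : ℝ) ^ msize α) • PiOp π (f α) e := by
  rw [orbit_PiOp_eq, (h.mTower_PiOp hb hf hd e).pD_eq α]
  simp [h.map_zero]

/-- Integration by parts: `Π(f)e_α = (-1)^|α| Π(∂^α f)e`. -/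
lemma PiOp_pD_orbit (h : ExpRep π C κ) (hb : κ < b) (hf : MTower f) (hd : MDec b f) {e : E}
    (he : ContDiff ℝ (⊤ : ℕ∞) (orbit π e)) (α : Fin d → ℕ) :
    PiOp π (f 0) (pD α (orbit π e) 0) = ((-1 : ℝ) ^ msize α) • PiOp π (f α) e := by
  have hE : EDec b (f 0) := ⟨hf.continuous 0, hd 0⟩
  obtain ⟨T, hT⟩ := h.exists_PiOp_clm hb hE
  have h1 := he.mTower_pD.comp_clm (T.restrictScalars ℝ)
  have h2 : (fun x => (T.restrictScalars ℝ) (pD (0 : Fin d → ℕ) (orbit π e) x)) =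
      orbit π (PiOp π (f 0) e) := by
    ext x
    rw [pD_zero]
    simp only [orbit, ContinuousLinearMap.coe_restrictScalars', hT, h.apply_PiOp hb hE]
  have h3 := congrFun (h1.pD_eq α) 0
  rw [h2, h.pD_orbit_PiOp hb hf hd] at h3
  rw [h3, ← hT]
  rfl

end ExpRep

lemma exists_tendsto_sum {ι V : Type*} [NormedAddCommGroup V] [CompleteSpace V] {t : ℕ → Finset ι}
    {u : ι → ℝ} (hu : Summable u) {f : ℕ → ι → V} (h0 : ∀ n i, i ∉ t n → f n i = 0)
    (hle : ∀ n i, ‖f n i‖ ≤ u i) (hlim : ∀ i, ∃ l, Tendsto (fun n => f n i) atTop (nhds l)) :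
    ∃ w, ‖w‖ ≤ ∑' i, u i ∧ Tendsto (fun n => ∑ i ∈ t n, f n i) atTop (nhds w) := by
  choose l hl using hlim
  have h1 : ∀ i, ‖l i‖ ≤ u i := fun i => le_of_tendsto (hl i).norm (.of_forall fun n => hle n i)
  refine ⟨∑' i, l i, tsum_of_norm_bounded hu.hasSum h1, ?_⟩
  have h2 := tendsto_tsum_of_dominated_convergence hu hl (.of_forall hle)
  refine h2.congr fun n => tsum_eq_sum fun i hi => h0 n i hi

lemma summable_pow_sum {d : ℕ} : Summable fun β : Fin d → ℕ => ∏ j, (1 / 2 : ℝ) ^ β j := by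
  refine summable_of_sum_le (c := 2 ^ d) (fun β => by positivity) fun u => ?_
  let N := u.sup fun β => ∑ j, β j
  have hsub : u ⊆ Fintype.piFinset fun _ => Finset.range (N + 1) := by
    intro β hβ
    rw [Fintype.mem_piFinset]
    intro j
    have h1 : ∑ j, β j ≤ N := Finset.le_sup (f := fun β : Fin d → ℕ => ∑ j, β j) hβ
    have h2 : β j ≤ ∑ j, β j := Finset.single_le_sum (fun _ _ => Nat.zero_le _) (Finset.mem_univ j)
    exact Finset.mem_range.2 (by omega)
  calc _ ≤ ∑ β ∈ Fintype.piFinset fun _ : Fin d => Finset.range (N + 1), ∏ j, (1 / 2 : ℝ) ^ β j :=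
        Finset.sum_le_sum_of_subset_of_nonneg hsub fun _ _ _ => by positivity
    _ = ∏ _j : Fin d, ∑ i ∈ Finset.range (N + 1), (1 / 2 : ℝ) ^ i :=
        (Finset.prod_univ_sum _ _).symm
    _ ≤ ∏ _j : Fin d, 2 := by
        refine Finset.prod_le_prod (fun _ _ => by positivity) fun _ _ => ?_
        exact (summable_geometric_two.sum_le_tsum _ fun _ _ => by positivity).trans_eq tsum_geometric_two
    _ = 2 ^ d := by simp

namespace FactorData

variable {d : ℕ} {M : ℕ → ℝ} {s : ℕ} {b ρ : ℝ}

lemma exists_tendsto_c (D : FactorData M s b ρ) (k : ℕ) : ∃ l, Tendsto (fun n => D.c n k) atTop (nhds l) := by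
  obtain ⟨K, -, hK⟩ := D.c_le
  exact ⟨_, tendsto_atTop_ciSup (D.c_mono k) ⟨_, Set.forall_mem_range.2 fun n => hK n k⟩⟩

/-- Convergence of the infinite order operator on a vector whose derivatives satisfy Roumieu bounds. -/
lemma exists_tendsto (D : FactorData M s b ρ) (hM : IsWeightSeq M) {C₀ H k : ℝ} (h2 : HasM2 M C₀ H)
    (hk : 0 < k) (hρ0 : 0 < ρ) (hρ : ρ * (k⁻¹ * H ^ d) ^ s ≤ 1 / 2)
    {V : Type*} [NormedAddCommGroup V] [NormedSpace ℝ V] [CompleteSpace V] :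
    ∃ A, ∀ (a : (Fin d → ℕ) → V) (C' : ℝ), (∀ α, k ^ msize α * ‖a α‖ ≤ C' * M (msize α)) →
      ∃ w, ‖w‖ ≤ A * C' ∧ Tendsto (fun n => ∑ β ∈ Fintype.piFinset fun _ => Finset.range (n + 1),
        (∏ j, D.c n (β j)) • a (fun j => s * β j)) atTop (nhds w) := by
  obtain ⟨K, hK0, hK⟩ := D.c_le
  obtain ⟨hC₀, hH, -⟩ := id h2
  refine ⟨K ^ d * C₀ ^ d * ∑' β : Fin d → ℕ, ∏ j, (1 / 2 : ℝ) ^ β j, fun a C' ha => ?_⟩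
  have hC' : 0 ≤ C' := by
    have h3 := ha 0
    have h4 : 0 ≤ k ^ msize (0 : Fin d → ℕ) * ‖a 0‖ := by positivity
    simp only [msize, Pi.zero_apply, Finset.sum_const_zero, hM.2.1, mul_one] at h3 h4
    exact h4.trans h3
  suffices h : ∃ w, ‖w‖ ≤ ∑' β : Fin d → ℕ, K ^ d * C₀ ^ d * C' * ∏ j, (1 / 2 : ℝ) ^ β j ∧
      Tendsto (fun n => ∑ β ∈ Fintype.piFinset fun _ => Finset.range (n + 1),
        (∏ j, D.c n (β j)) • a (fun j => s * β j)) atTop (nhds w) by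
    obtain ⟨w, hw1, hw2⟩ := h
    refine ⟨w, hw1.trans (le_of_eq ?_), hw2⟩
    rw [tsum_mul_left]
    ring
  refine exists_tendsto_sum (summable_pow_sum.mul_left _) ?_ ?_ ?_
  · intro n β hβ
    simp only [Fintype.mem_piFinset, not_forall, Finset.mem_range, not_lt] at hβ
    obtain ⟨j, hj⟩ := hβ
    rw [Finset.prod_eq_zero (Finset.mem_univ j) (D.c_zero n _ (by omega)), zero_smul]
  · intro n β
    have hMp := hM.1
    have h3 : ‖a fun j => s * β j‖ ≤ C' * (k⁻¹ ^ (∑ j, s * β j) * (C₀ ^ d * (H ^ d) ^ (∑ j, s * β j) *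
        ∏ j, M (s * β j))) := by
      have h4 := ha fun j => s * β j
      have h5 := M_sum_le hM h2 Finset.univ fun j => s * β j
      simp only [Finset.card_univ, Fintype.card_fin] at h5
      rw [mul_comm, ← le_div_iff₀ (by positivity)] at h4
      refine h4.trans ?_
      rw [div_eq_mul_inv, ← inv_pow, mul_assoc, mul_comm (M _)]
      simp only [msize]
      gcongr
    rw [norm_smul, Real.norm_of_nonneg (Finset.prod_nonneg fun j _ => D.c_nonneg _ _)]
    calc _ ≤ (∏ j, (K * ρ ^ β j / M (s * β j))) * _ :=
          mul_le_mul (Finset.prod_le_prod (fun j _ => D.c_nonneg _ _) fun j _ => hK _ _) h3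
            (norm_nonneg _) (Finset.prod_nonneg fun j _ => by have := hMp (s * β j); positivity)
      _ = K ^ d * C₀ ^ d * C' * ∏ j, (ρ * (k⁻¹ * H ^ d) ^ s) ^ β j := by
          have h6 : ∏ j, M (s * β j) ≠ 0 := Finset.prod_ne_zero_iff.2 fun j _ => (hMp _).ne'
          rw [Finset.prod_div_distrib, Finset.prod_mul_distrib, Finset.prod_const]
          simp only [mul_pow, Finset.prod_mul_distrib, ← pow_mul, Finset.prod_pow_eq_pow_sum, Finset.card_univ,
            Fintype.card_fin, ← Finset.mul_sum]
          field_simp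
          ring
      _ ≤ _ := by
          gcongr
  · intro β
    choose l hl using D.exists_tendsto_c
    exact ⟨_, (tendsto_finsetProd _ fun j _ => hl (β j)).smul_const _⟩

end FactorData

lemma tens_gaussK {d : ℕ} {ε : ℝ} (x : Rd d) :
    tens d (gaussK ε) x = ((ε⁻¹ ^ d : ℝ) : ℂ) * tens d (gaussK 1) (ε⁻¹ • x) := by
  simp [tens, gaussK, Finset.prod_mul_distrib]

lemma integral_tens_gaussK_one (d : ℕ) : ∫ x : Rd d, tens d (gaussK 1) x = 1 := by
  have h1 := integral_tens_mul_tens (d := d) (gaussK 1) (fun _ => 1) 0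
  have h2 : ∫ x : ℝ, gaussK 1 x = 1 := by
    simp only [gaussK, inv_one, one_mul]
    rw [integral_complex_ofReal, integral_gaussian, div_self Real.pi_ne_zero]
    simp
  simpa [tens, h2] using h1

lemma continuous_tens {d : ℕ} {F : ℝ → ℂ} (hF : Continuous F) : Continuous (tens d F) := by
  unfold tens
  fun_prop

lemma continuous_gaussK (ε : ℝ) : Continuous (gaussK ε) := by
  unfold gaussK
  fun_prop

lemma FactorData.eDec_gaussK {d : ℕ} {M : ℕ → ℝ} {s : ℕ} {b ρ : ℝ} (D : FactorData M s b ρ) (hb : 0 ≤ b)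
    {ε : ℝ} (hε : 0 < ε) : EDec b (tens d (gaussK ε)) := by
  obtain ⟨K, hK⟩ := D.gauss_le ε hε
  have h1 : ∀ z, ‖gaussK ε z‖ ≤ K * Real.exp (-(b * |z|)) := fun z =>
    le_of_tendsto (D.gauss_tendsto ε hε z).norm (.of_forall fun n => hK n z)
  have hK0 : 0 ≤ K := by simpa using (norm_nonneg _).trans (h1 0)
  exact ⟨continuous_tens (continuous_gaussK ε), K ^ d, by positivity, norm_tens_le hb hK0 h1⟩

namespace ExpRep

variable {d : ℕ} {E : Type*} [NormedAddCommGroup E] [NormedSpace ℂ E] [CompleteSpace E]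
  {π : Rd d → E →L[ℂ] E} {C κ b : ℝ}

lemma PiOp_gaussK {ε : ℝ} (hε : 0 < ε) (w : E) :
    PiOp π (tens d (gaussK ε)) w = ∫ x, tens d (gaussK 1) x • π (ε • x) w := by
  have h1 := Measure.integral_comp_smul (volume : Measure (Rd d))
    (fun x => tens d (gaussK 1) x • π (ε • x) w) ε⁻¹
  have h2 : ∀ x : Rd d, ε • ε⁻¹ • x = x := fun x => smul_inv_smul₀ hε.ne' x
  simp only [h2, finrank_euclideanSpace, Fintype.card_fin] at h1
  simp only [PiOp, tens_gaussK (ε := ε), mul_smul]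
  rw [integral_smul, h1, abs_of_pos (by positivity), Complex.coe_smul, smul_smul, inv_pow, inv_inv,
    inv_mul_cancel₀ (by positivity), one_smul]

lemma tendsto_PiOp_gaussK (h : ExpRep π C κ) (hb : κ < b) (hg : EDec b (tens d (gaussK 1))) (w : E) :
    Tendsto (fun n : ℕ => PiOp π (tens d (gaussK (1 / ((n : ℝ) + 1)))) w) atTop (nhds w) := by
  have hκ := h.κ_pos
  have hC := h.C_pos
  obtain ⟨K, hK0, hK⟩ := hg.2
  have h1 : Tendsto (fun n : ℕ => ∫ x, tens d (gaussK 1) x • π ((1 / ((n : ℝ) + 1)) • x) w) atTop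
      (nhds (∫ x, tens d (gaussK 1) x • w)) := by
    refine tendsto_integral_of_dominated_convergence
      (fun x => K * C * ‖w‖ * Real.exp (-((b - κ) * ‖x‖))) (fun n => ?_)
      ((integrable_exp_neg_norm d (sub_pos.2 hb)).const_mul _) (fun n => .of_forall fun x => ?_)
      (.of_forall fun x => ?_)
    · have h2 := h.continuous_orbit w
      have h3 := hg.1
      exact Continuous.aestronglyMeasurable (by fun_prop)
    · have hn : ‖(1 / ((n : ℝ) + 1)) • x‖ ≤ ‖x‖ := by
        rw [norm_smul, Real.norm_of_nonneg (by positivity)]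
        refine mul_le_of_le_one_left (norm_nonneg _) ?_
        rw [div_le_one (by positivity)]
        have : (0 : ℝ) ≤ n := n.cast_nonneg
        linarith
      rw [norm_smul]
      calc _ ≤ (K * Real.exp (-(b * ‖x‖))) * (C * Real.exp (κ * ‖x‖) * ‖w‖) := by
            gcongr
            · exact hK x
            · exact (h.growth _ _).trans (by gcongr)
        _ = K * C * ‖w‖ * (Real.exp (-(b * ‖x‖)) * Real.exp (κ * ‖x‖)) := by ring
        _ = _ := by rw [← Real.exp_add]; ring_nf
    · have h2 : Tendsto (fun n : ℕ => (1 / ((n : ℝ) + 1)) • x) atTop (nhds 0) := by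
        simpa using (tendsto_one_div_add_atTop_nhds_zero_nat (𝕜 := ℝ)).smul_const x
      have h3 := ((h.continuous_orbit w).tendsto 0).comp h2
      rw [h.map_zero] at h3
      exact h3.const_smul _
  rw [integral_smul_const, integral_tens_gaussK_one, one_smul] at h1
  exact h1.congr fun n => (PiOp_gaussK (by positivity) w).symm

lemma eq_of_PiOp_gaussK_eq (h : ExpRep π C κ) (hb : κ < b) (hg : EDec b (tens d (gaussK 1))) {v w : E}
    (hvw : ∀ ε, 0 < ε → PiOp π (tens d (gaussK ε)) v = PiOp π (tens d (gaussK ε)) w) : v = w :=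
  tendsto_nhds_unique (h.tendsto_PiOp_gaussK hb hg v)
    ((h.tendsto_PiOp_gaussK hb hg w).congr fun n => (hvw _ (by positivity)).symm)

end ExpRep

lemma FactorData.mDec {d : ℕ} {F : ℕ → ℝ → ℂ} {M : ℕ → ℝ} (hM : IsWeightSeq M) {b : ℝ} (hb : 0 ≤ b)
    (h : ∃ L, 0 < L ∧ ∃ K, 0 ≤ K ∧ ∀ n x, ‖F n x‖ ≤ K * L ^ n * M n * Real.exp (-(b * |x|))) :
    MDec b (mtens F : (Fin d → ℕ) → Rd d → ℂ) := by
  obtain ⟨L, hL, K, hK, hF⟩ := h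
  have hMp := hM.1
  intro α
  exact ⟨_, by have := hMp (msize α); positivity, norm_mtens_le hM hb hK hL.le hF α⟩

/-- The partial sums of the infinite order operator applied to `χ ⊗ ⋯ ⊗ χ`. -/
def FactorData.opSum {M : ℕ → ℝ} {s : ℕ} {b ρ : ℝ} (D : FactorData M s b ρ) (n : ℕ) (x : ℝ) : ℂ :=
  ∑ k ∈ Finset.range (n + 1), (D.c n k : ℂ) * D.χ (s * k) x

lemma FactorData.tens_opSum {d : ℕ} {M : ℕ → ℝ} {s : ℕ} {b ρ : ℝ} (D : FactorData M s b ρ) (n : ℕ) (x : Rd d) :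
    tens d (D.opSum n) x = ∑ β ∈ Fintype.piFinset fun _ : Fin d => Finset.range (n + 1),
      ((∏ j, D.c n (β j) : ℝ) : ℂ) * mtens D.χ (fun j => s * β j) x := by
  simp only [tens, FactorData.opSum, mtens]
  rw [Finset.prod_univ_sum]
  simp [Finset.prod_mul_distrib]

lemma FactorData.eDec_tens_opSum {d : ℕ} {M : ℕ → ℝ} {s : ℕ} {b ρ : ℝ} (D : FactorData M s b ρ) (hb : 0 ≤ b)
    (hM : IsWeightSeq M) (n : ℕ) : EDec b (tens d (D.opSum n)) := by
  obtain ⟨L, hL, K, hK, hF⟩ := D.χ_le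
  have hMp := hM.1
  have hc : ∀ m, Continuous (D.χ m) := fun m =>
    continuous_iff_continuousAt.2 fun x => (D.χ_deriv m x).continuousAt
  refine ⟨continuous_tens ?_, (∑ k ∈ Finset.range (n + 1), D.c n k * (K * L ^ (s * k) * M (s * k))) ^ d, ?_,
    norm_tens_le hb ?_ fun x => ?_⟩
  · unfold FactorData.opSum
    fun_prop
  · refine pow_nonneg (Finset.sum_nonneg fun k _ => ?_) _
    have := hMp (s * k)
    have := D.c_nonneg n k
    positivity
  · refine Finset.sum_nonneg fun k _ => ?_
    have := hMp (s * k)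
    have := D.c_nonneg n k
    positivity
  · rw [Finset.sum_mul]
    refine norm_sum_le_of_le _ fun k _ => ?_
    rw [norm_mul, Complex.norm_real, Real.norm_of_nonneg (D.c_nonneg n k), mul_assoc]
    exact mul_le_mul_of_nonneg_left (hF _ _) (D.c_nonneg n k)

namespace ExpRep

variable {d : ℕ} {E : Type*} [NormedAddCommGroup E] [NormedSpace ℂ E] [CompleteSpace E]
  {π : Rd d → E →L[ℂ] E} {C κ b ρ : ℝ} {M : ℕ → ℝ} {s : ℕ}

lemma PiOp_finset_sum (h : ExpRep π C κ) (hb : κ < b) {ι : Type*} (t : Finset ι) (c : ι → ℝ)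
    {f : ι → Rd d → ℂ} (hf : ∀ i, EDec b (f i)) (e : E) :
    PiOp π (fun x => ∑ i ∈ t, (c i : ℂ) * f i x) e = ∑ i ∈ t, c i • PiOp π (f i) e := by
  simp only [PiOp, Finset.sum_smul, mul_smul]
  have h1 : ∀ i ∈ t, Integrable fun x => (c i : ℂ) • f i x • π x e :=
    fun i _ => (h.integrable hb (hf i) e).smul _
  rw [integral_finsetSum _ h1]
  refine Finset.sum_congr rfl fun i _ => ?_
  rw [integral_smul, Complex.coe_smul]

lemma PiOp_tens_χ (h : ExpRep π C κ) (hb : κ < b) (hM : IsWeightSeq M) (D : FactorData M s b ρ) (hs : Even s)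
    {e : E} (he : ContDiff ℝ (⊤ : ℕ∞) (orbit π e)) (n : ℕ) :
    PiOp π (tens d (D.χ 0)) (∑ β ∈ Fintype.piFinset fun _ => Finset.range (n + 1),
      (∏ j, D.c n (β j)) • pD (fun j => s * β j) (orbit π e) 0) = PiOp π (tens d (D.opSum n)) e := by
  have hT := mTower_mtens (d := d) D.χ_deriv
  have hd : MDec b (mtens D.χ : (Fin d → ℕ) → Rd d → ℂ) :=
    FactorData.mDec hM (h.κ_pos.trans hb).le D.χ_le
  have hE : ∀ β, EDec b (mtens D.χ β : Rd d → ℂ) := fun β => ⟨hT.continuous β, hd β⟩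
  have h1 : tens d (D.opSum n) = fun x => ∑ β ∈ Fintype.piFinset fun _ : Fin d => Finset.range (n + 1),
      ((∏ j, D.c n (β j) : ℝ) : ℂ) * mtens D.χ (fun j => s * β j) x := funext fun x => D.tens_opSum n x
  rw [h1, h.PiOp_finset_sum hb _ _ fun β => hE _, ← mtens_zero]
  obtain ⟨T, hTT⟩ := h.exists_PiOp_clm hb (hE 0)
  rw [← hTT, map_sum]
  refine Finset.sum_congr rfl fun β _ => ?_
  rw [T.map_smul_of_tower]
  have h2 : Even (msize fun j => s * β j) := by
    rw [msize, ← Finset.mul_sum]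
    exact hs.mul_right _
  rw [hTT, h.PiOp_pD_orbit hb hT hd he, h2.neg_one_pow, one_smul]

lemma tendsto_PiOp_gaussK_opSum (h : ExpRep π C κ) (hb : κ < b) (hM : IsWeightSeq M) (D : FactorData M s b ρ)
    {ε : ℝ} (hε : 0 < ε) (e : E) :
    Tendsto (fun n => PiOp π (tens d (gaussK ε)) (PiOp π (tens d (D.opSum n)) e)) atTop
      (nhds (PiOp π (tens d (gaussK ε)) e)) := by
  have hb0 := (h.κ_pos.trans hb).le
  have hg := D.eDec_gaussK (d := d) hb0 hε
  have hn := D.eDec_tens_opSum (d := d) hb0 hM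
  simp only [fun n => h.PiOp_PiOp hb hg (hn n) e]
  obtain ⟨K, hK⟩ := D.gauss_le ε hε
  have hK0 : 0 ≤ K := by simpa using (norm_nonneg _).trans (hK 0 0)
  unfold PiOp
  refine tendsto_integral_of_dominated_convergence
    (fun x => K ^ d * C * ‖e‖ * Real.exp (-((b - κ) * ‖x‖))) (fun n => ?_)
    ((integrable_exp_neg_norm d (sub_pos.2 hb)).const_mul _) (fun n => .of_forall fun z => ?_)
    (.of_forall fun z => ?_)
  · have h1 : Continuous (Function.uncurry fun (z x : Rd d) => tens d (gaussK ε) x * tens d (D.opSum n) (z - x)) := by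
      have := hg.1
      have := (hn n).1
      fun_prop
    exact (h1.stronglyMeasurable.integral_prod_right (ν := volume)).aestronglyMeasurable.smul
      (h.continuous_orbit e).aestronglyMeasurable
  · refine h.norm_smul_le (f := fun z => ∫ x, tens d (gaussK ε) x * tens d (D.opSum n) (z - x)) ?_ e
    simp only [integral_tens_mul_tens]
    exact norm_tens_le hb0 hK0 (fun t => hK n t) z
  · simp only [integral_tens_mul_tens]
    exact (tendsto_finsetProd _ fun j _ => D.gauss_tendsto ε hε (z j)).smul_const _

/-- The factorization `Π(ψ)Π(θ)w = e`, where `w` is the infinite order operator applied to `e`. -/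
lemma PiOp_factor (h : ExpRep π C κ) (hb : κ < b) (hM : IsWeightSeq M) (D : FactorData M s b ρ) (hs : Even s)
    {e w : E} (he : ContDiff ℝ (⊤ : ℕ∞) (orbit π e))
    (hw : Tendsto (fun n => ∑ β ∈ Fintype.piFinset fun _ => Finset.range (n + 1),
      (∏ j, D.c n (β j)) • pD (fun j => s * β j) (orbit π e) 0) atTop (nhds w)) :
    PiOp π (tens d (D.ψ 0)) (PiOp π (tens d (D.θ 0)) w) = e := by
  have hb0 := h.κ_pos.trans hb
  obtain ⟨L, hL, hψ⟩ := D.ψ_le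
  have hψd : EDec b (tens d (D.ψ 0)) := ⟨(mTower_mtens D.ψ_deriv).continuous 0,
    FactorData.mDec hM hb0.le ⟨L, hL, hψ b hb0⟩ 0⟩
  have hθd : EDec b (tens d (D.θ 0)) := ⟨(mTower_mtens D.θ_deriv).continuous 0,
    FactorData.mDec hM hb0.le D.θ_le 0⟩
  have hχd : EDec b (tens d (D.χ 0)) := ⟨(mTower_mtens D.χ_deriv).continuous 0,
    FactorData.mDec hM hb0.le D.χ_le 0⟩
  have h1 : PiOp π (tens d (D.ψ 0)) (PiOp π (tens d (D.θ 0)) w) = PiOp π (tens d (D.χ 0)) w := by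
    rw [h.PiOp_PiOp hb hψd hθd]
    congr 1
    ext z
    rw [integral_tens_mul_tens]
    simp only [D.conv, tens]
  rw [h1]
  refine h.eq_of_PiOp_gaussK_eq hb (D.eDec_gaussK hb0.le one_pos) fun ε hε => ?_
  refine tendsto_nhds_unique ?_ (h.tendsto_PiOp_gaussK_opSum hb hM D hε e)
  obtain ⟨T, hT⟩ := h.exists_PiOp_clm hb hχd
  obtain ⟨S, hS⟩ := h.exists_PiOp_clm hb (D.eDec_gaussK hb0.le hε)
  simp only [← fun n => h.PiOp_tens_χ hb hM D hs he n, ← hT, ← hS]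
  exact ((S.comp T).continuous.tendsto w).comp hw

end ExpRep

lemma KRou.exists_decay {d : ℕ} {M : ℕ → ℝ} (hM : IsWeightSeq M) {f : Rd d → ℂ} (hf : KRou d M f) (b : ℝ) :
    ∃ L K, 0 < L ∧ 0 ≤ K ∧ ∀ α x, ‖pD α f x‖ ≤ K * L ^ msize α * M (msize α) * Real.exp (-(b * ‖x‖)) := by
  obtain ⟨-, k, hk, hn⟩ := hf
  obtain ⟨n, hbn⟩ := exists_nat_gt b
  obtain ⟨K, hK⟩ := hn n
  have hMp := hM.1
  have hK0 : 0 ≤ K := by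
    have h1 := (by positivity : 0 ≤ k ^ msize 0 * ‖pD (0 : Fin d → ℕ) f 0‖ * Real.exp ((n : ℝ) * ‖(0 : Rd d)‖)).trans
      (hK 0 0)
    exact nonneg_of_mul_nonneg_left h1 (hMp _)
  refine ⟨k⁻¹, K, inv_pos.2 hk, hK0, fun α x => ?_⟩
  have h1 := hK α x
  calc ‖pD α f x‖ = (k ^ msize α * ‖pD α f x‖ * Real.exp ((n : ℝ) * ‖x‖)) *
        (k⁻¹ ^ msize α * Real.exp (-((n : ℝ) * ‖x‖))) := by
        rw [Real.exp_neg, inv_pow]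
        field_simp
    _ ≤ (K * M (msize α)) * (k⁻¹ ^ msize α * Real.exp (-(b * ‖x‖))) := by
        have := hMp (msize α)
        gcongr
    _ = _ := by ring

lemma FactorData.kRou_ψ {M : ℕ → ℝ} {s : ℕ} {b ρ : ℝ} (D : FactorData M s b ρ) (d : ℕ) (hM : IsWeightSeq M) :
    KRou d M (tens d (D.ψ 0)) := by
  have hT := mTower_mtens (d := d) D.ψ_deriv
  obtain ⟨L, hL, hψ⟩ := D.ψ_le
  refine ⟨hT.contDiff 0, L⁻¹, inv_pos.2 hL, fun n => ?_⟩
  obtain ⟨K, hK0, hK⟩ := hψ (n + 1) (by positivity)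
  refine ⟨K ^ d, fun α x => ?_⟩
  have hMp := hM.1 (msize α)
  rw [← mtens_zero, hT.pD_eq α]
  calc _ ≤ L⁻¹ ^ msize α * (K ^ d * L ^ msize α * M (msize α) * Real.exp (-((n + 1) * ‖x‖))) *
        Real.exp (n * ‖x‖) := by
        gcongr
        exact norm_mtens_le hM (by positivity) hK0 hL.le hK α x
    _ = K ^ d * M (msize α) * (Real.exp (-((n + 1) * ‖x‖)) * Real.exp (n * ‖x‖)) := by
        rw [inv_pow]
        field_simp
    _ ≤ K ^ d * M (msize α) * 1 := by
        rw [← Real.exp_add]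
        gcongr
        rw [Real.exp_le_one_iff]
        linarith [norm_nonneg x]
    _ = _ := mul_one _

namespace ExpRep

variable {d : ℕ} {E : Type*} [NormedAddCommGroup E] [NormedSpace ℂ E] [CompleteSpace E]
  {π : Rd d → E →L[ℂ] E} {C κ b : ℝ} {M : ℕ → ℝ}

/-- If the derivatives of `f` satisfy Roumieu bounds with exponential decay, then `Π(f)` maps bounded
sets of `E` to bounded sets of Roumieu vectors. -/
lemma uvRouBdd_PiOp (h : ExpRep π C κ) (hb : κ < b) (hM : IsWeightSeq M) {f : (Fin d → ℕ) → Rd d → ℂ}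
    (hf : MTower f) {L K : ℝ} (hL : 0 < L) (hK : 0 ≤ K)
    (hle : ∀ α x, ‖f α x‖ ≤ K * L ^ msize α * M (msize α) * Real.exp (-(b * ‖x‖)))
    {S : Set E} {R : ℝ} (hS : ∀ e ∈ S, ‖e‖ ≤ R) : UVRouBdd d M π (PiOp π (f 0) '' S) := by
  have hMp := hM.1
  have hd : MDec b f := fun α => ⟨_, by have := hMp (msize α); positivity, hle α⟩
  have hI : 0 ≤ C * ∫ x : Rd d, Real.exp (-((b - κ) * ‖x‖)) :=
    mul_nonneg h.C_pos.le (integral_nonneg fun x => (Real.exp_pos _).le)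
  have key : ∀ e ∈ S, ∀ α : Fin d → ℕ, L⁻¹ ^ msize α * ‖pD α (orbit π (PiOp π (f 0) e)) 0‖ ≤
      K * (C * ∫ x : Rd d, Real.exp (-((b - κ) * ‖x‖))) * R * M (msize α) := by
    intro e he α
    rw [h.pD_orbit_PiOp hb hf hd, norm_smul, norm_pow, norm_neg, norm_one, one_pow, one_mul]
    calc _ ≤ L⁻¹ ^ msize α * (K * L ^ msize α * M (msize α) *
          (C * ∫ x : Rd d, Real.exp (-((b - κ) * ‖x‖))) * ‖e‖) := by
          gcongr
          exact h.norm_PiOp_le hb (hle α) e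
      _ = K * (C * ∫ x : Rd d, Real.exp (-((b - κ) * ‖x‖))) * ‖e‖ * M (msize α) := by
          rw [inv_pow]
          field_simp
      _ ≤ _ := by
          have := (hMp (msize α)).le
          gcongr
          exact hS e he
  refine ⟨?_, L⁻¹, inv_pos.2 hL, _, Set.forall_mem_image.2 key⟩
  exact Set.forall_mem_image.2 fun e he =>
    ⟨h.contDiff_orbit_PiOp hb hf hd e, L⁻¹, inv_pos.2 hL, _, key e he⟩

lemma uvRou_PiOp (h : ExpRep π C κ) (hM : IsWeightSeq M) {f : Rd d → ℂ} (hf : KRou d M f) (e : E) :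
    UVRou d M π (PiOp π f e) := by
  obtain ⟨L, K, hL, hK, hle⟩ := hf.exists_decay hM (κ + 1)
  have h1 := h.uvRouBdd_PiOp (lt_add_one κ) hM hf.1.mTower_pD hL hK hle (S := {e}) (R := ‖e‖) (by simp)
  simpa [pD_zero] using h1.1

/-- Factorization of bounded sets of Roumieu vectors. -/
lemma exists_factor (h : ExpRep π C κ) (hM : IsWeightSeq M) (hM2 : M2 M) (h2s : M2star M) {B : Set E}
    (hB : UVRouBdd d M π B) :
    ∃ ψ : Rd d → ℂ, KRou d M ψ ∧ ∃ A : Set E, UVRouBdd d M π A ∧ PiOp π ψ '' A = B := by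
  obtain ⟨hBd, k, hk, C', hC'⟩ := hB
  obtain ⟨C₀, H, hCH⟩ := id hM2
  obtain ⟨s, hs, hD⟩ := exists_factorData hM hM2 h2s
  have hH : 0 < H := one_pos.trans_le hCH.2.1
  have hq : 0 < (k⁻¹ * H ^ d) ^ s := by positivity
  have hb : κ < κ + 1 := lt_add_one κ
  have hb0 : 0 < κ + 1 := h.κ_pos.trans hb
  obtain ⟨D⟩ := hD (κ + 1) (1 / 2 / (k⁻¹ * H ^ d) ^ s) hb0 (by positivity)
  obtain ⟨R, hR⟩ := D.exists_tendsto (d := d) hM hCH hk (by positivity) (by field_simp; rfl) (V := E)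
  choose! w hwR hw using fun e (he : e ∈ B) => hR (fun α => pD α (orbit π e) 0) C' (hC' e he)
  obtain ⟨L, hL, K, hK, hθ⟩ := D.θ_le
  refine ⟨tens d (D.ψ 0), D.kRou_ψ d hM, PiOp π (tens d (D.θ 0)) '' (w '' B),
    h.uvRouBdd_PiOp hb hM (mTower_mtens D.θ_deriv) hL (pow_nonneg hK d)
      (norm_mtens_le hM hb0.le hK hL.le hθ) (Set.forall_mem_image.2 hwR), ?_⟩
  rw [Set.image_image, Set.image_image]
  refine (Set.image_congr fun e he => ?_).trans (Set.image_id B)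
  exact h.PiOp_factor hb hM D hs (hBd e he).1 (hw e he)

end ExpRep

/-- Strong factorization theorem (Theorem 3.3) for Banach representations of `(ℝ^d,+)`,
Roumieu case: `Π(𝒦^{{M}})E = Π(𝒦^{{M}})E^{{M}} = E^{{M}}`, with factorization of
bounded sets. -/
theorem stmt13 (d : ℕ) (M : ℕ → ℝ) (hM : IsWeightSeq M) (hM2 : M2 M) (h2s : M2star M)
    {E : Type*} [NormedAddCommGroup E] [NormedSpace ℂ E] [CompleteSpace E]
    (π : Rd d → E →L[ℂ] E)
    (hπ0 : π 0 = ContinuousLinearMap.id ℂ E)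
    (hπadd : ∀ x y : Rd d, π (x + y) = (π x).comp (π y))
    (hπcont : Continuous fun p : Rd d × E => π p.1 p.2)
    (C κ : ℝ) (hC : 0 < C) (hκ : 0 < κ)
    (hgrowth : ∀ (x : Rd d) (e : E), ‖π x e‖ ≤ C * Real.exp (κ * ‖x‖) * ‖e‖) :
    ({v : E | ∃ f : Rd d → ℂ, KRou d M f ∧ ∃ e : E, v = PiOp π f e} =
        {v : E | UVRou d M π v}) ∧
    ({v : E | ∃ f : Rd d → ℂ, KRou d M f ∧ ∃ e : E, UVRou d M π e ∧ v = PiOp π f e} =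
        {v : E | UVRou d M π v}) ∧
    ∀ Bt : Set E, UVRouBdd d M π Bt →
      ∃ ψ : Rd d → ℂ, KRou d M ψ ∧
        ∃ At : Set E, UVRouBdd d M π At ∧ (PiOp π ψ) '' At = Bt := by
  have h : ExpRep π C κ := ⟨hπ0, hπadd, hπcont, hC, hκ, hgrowth⟩
  have hfac : ∀ v, UVRou d M π v → ∃ f : Rd d → ℂ, KRou d M f ∧ ∃ e : E, UVRou d M π e ∧ v = PiOp π f e := by
    intro v hv
    obtain ⟨k, hk, C', hC'⟩ := hv.2
    obtain ⟨ψ, hψ, A, hA, hAv⟩ := h.exists_factor hM hM2 h2s (B := {v})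
      ⟨by simpa using hv, k, hk, C', by simpa using hC'⟩
    obtain ⟨e, he, hev⟩ : v ∈ PiOp π ψ '' A := hAv ▸ Set.mem_singleton v
    exact ⟨ψ, hψ, e, hA.1 e he, hev.symm⟩
  refine ⟨Set.ext fun v => ⟨?_, ?_⟩, Set.ext fun v => ⟨?_, hfac v⟩, fun B hB => h.exists_factor hM hM2 h2s hB⟩
  · rintro ⟨f, hf, e, rfl⟩
    exact h.uvRou_PiOp hM hf e
  · intro hv
    obtain ⟨f, hf, e, -, he⟩ := hfac v hv
    exact ⟨f, hf, e, he⟩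
  · rintro ⟨f, hf, e, -, rfl⟩
    exact h.uvRou_PiOp hM hf e
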